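/- arXiv:1601.02390 — 4 statements merged into one kernel-verified Lean document; each statement's English description precedes it below -/
import Mathlib

section
/- For every t > 0, the function τ ↦ I(t−τ)·(−γ − log τ) is integrable on (0, t) and ∫₀ᵗ I(t−τ)·(−γ − log τ) dτ = 1, where γ is the Euler–Mascheroni constant. -/
open MeasureTheory Real

/-- The Volterra function of order `-1`: `I(t) = ∫₀^∞ t^(σ-1)/Γ(σ) dσ`. -/
noncomputable def volterraI (t : ℝ) : ℝ :=
  ∫ σ in Set.Ioi (0 : ℝ), t ^ (σ - 1) / Real.Gamma σ

open Set Filter Topology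

/-- Complex beta integral over `(0,t)`. -/
lemma vol_beta_complex {t : ℝ} (ht : 0 < t) {s : ℂ} (hs : 0 < s.re) {b : ℝ} (hb : 0 < b) :
    ∫ x in Ioo (0:ℝ) t, (x:ℂ) ^ (s - 1) * (((t - x) ^ (b - 1) : ℝ) : ℂ)
      = (t:ℂ) ^ (s + b - 1) * (Complex.Gamma s * Complex.Gamma b / Complex.Gamma (s + b)) := by
  rw [← Complex.betaIntegral_eq_Gamma_mul_div s b hs (by simpa using hb),
    ← Complex.betaIntegral_scaled s b ht, intervalIntegral.integral_of_le ht.le,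
    integral_Ioc_eq_integral_Ioo]
  refine setIntegral_congr_fun measurableSet_Ioo fun x hx => ?_
  have : 0 ≤ t - x := by linarith [hx.2]
  rw [Complex.ofReal_cpow this]
  push_cast
  rfl

lemma vol_beta_real {t : ℝ} (ht : 0 < t) {a b : ℝ} (ha : 0 < a) (hb : 0 < b) :
    ∫ x in Ioo (0:ℝ) t, x ^ (a - 1) * (t - x) ^ (b - 1)
      = t ^ (a + b - 1) * (Real.Gamma a * Real.Gamma b / Real.Gamma (a + b)) := by
  have h := vol_beta_complex ht (s := (a:ℂ)) (by simpa using ha) hb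
  apply Complex.ofReal_injective
  rw [← integral_complex_ofReal]
  push_cast
  rw [Complex.ofReal_cpow ht.le, ← Complex.Gamma_ofReal, ← Complex.Gamma_ofReal,
    ← Complex.Gamma_ofReal]
  push_cast
  rw [← h]
  refine setIntegral_congr_fun measurableSet_Ioo fun x hx => ?_
  rw [Complex.ofReal_cpow hx.1.le]
  push_cast
  rfl

lemma vol_beta_integrable {t : ℝ} (ht : 0 < t) {a b : ℝ} (ha : 0 < a) (hb : 0 < b) :
    IntegrableOn (fun x => x ^ (a - 1) * (t - x) ^ (b - 1)) (Ioo (0:ℝ) t) := by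
  by_contra hcon
  have h := vol_beta_real ht ha hb
  rw [integral_undef hcon] at h
  have h1 := Real.Gamma_pos_of_pos ha
  have h2 := Real.Gamma_pos_of_pos hb
  have h3 := Real.Gamma_pos_of_pos (add_pos ha hb)
  have : 0 < t ^ (a + b - 1) * (Real.Gamma a * Real.Gamma b / Real.Gamma (a + b)) := by
    positivity
  linarith

lemma vol_Gamma_lower {M x : ℝ} (hM : 0 < M) (hx : 1 ≤ x) :
    M ^ (x - 1) * Real.exp (-M) ≤ Real.Gamma x := by
  have hx0 : 0 < x := by linarith
  rw [Real.Gamma_eq_integral hx0, ← integral_exp_neg_Ioi, ← integral_const_mul]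
  have hint := Real.GammaIntegral_convergent hx0
  calc ∫ u in Ioi M, M ^ (x - 1) * Real.exp (-u)
      ≤ ∫ u in Ioi M, Real.exp (-u) * u ^ (x - 1) := by
        refine setIntegral_mono_on ?_ (hint.mono_set (Ioi_subset_Ioi hM.le)) measurableSet_Ioi ?_
        · refine Integrable.const_mul ?_ _
          have h9 := exp_neg_integrableOn_Ioi M one_pos
          simp only [neg_mul, one_mul] at h9
          exact h9
        · intro u hu
          rw [mul_comm]
          have hu' : M < u := hu
          gcongr
    _ ≤ _ := by
        refine setIntegral_mono_set hint ?_ (Ioi_subset_Ioi hM.le).eventuallyLE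
        refine (ae_restrict_iff' measurableSet_Ioi).2 (Eventually.of_forall fun u hu => ?_)
        have hu' : (0:ℝ) < u := hu
        simp only [Pi.zero_apply]
        positivity

lemma vol_continuous_Gamma_inv : Continuous fun x : ℝ => (Real.Gamma x)⁻¹ := by
  have h : Continuous fun x : ℝ => ((Complex.Gamma (x:ℂ))⁻¹).re :=
    Complex.continuous_re.comp
      (Complex.differentiable_one_div_Gamma.continuous.comp Complex.continuous_ofReal)
  refine h.congr fun x => ?_
  rw [Complex.Gamma_ofReal, ← Complex.ofReal_inv, Complex.ofReal_re]

/-- exponential decay -/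
lemma vol_decay {t : ℝ} (ht : 0 < t) {x : ℝ} (hx : 1 ≤ x) :
    t ^ (x - 1) / Real.Gamma x ≤ Real.exp (Real.exp 1 * t) * Real.exp 1 * Real.exp (-x) := by
  have hM : 0 < Real.exp 1 * t := by positivity
  have h := vol_Gamma_lower hM hx
  have hG := Real.Gamma_pos_of_pos (by linarith : 0 < x)
  rw [div_le_iff₀ hG]
  refine le_trans (le_of_eq ?_) (mul_le_mul_of_nonneg_left h (by positivity))
  rw [Real.mul_rpow (by positivity) ht.le, ← Real.exp_mul]
  have : Real.exp (Real.exp 1 * t) * Real.exp 1 * Real.exp (-x) *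
      (Real.exp (1 * (x - 1)) * t ^ (x - 1) * Real.exp (-(Real.exp 1 * t)))
      = (Real.exp (Real.exp 1 * t) * Real.exp (-(Real.exp 1 * t))) *
        (Real.exp 1 * Real.exp (-x) * Real.exp (1 * (x - 1))) * t ^ (x - 1) := by ring
  rw [this, ← Real.exp_add, ← Real.exp_add, ← Real.exp_add]
  have e1 : Real.exp 1 * t + -(Real.exp 1 * t) = 0 := by ring
  have e2 : 1 + -x + 1 * (x - 1) = 0 := by ring
  rw [e1, e2]
  simp

lemma vol_integrable_half {t : ℝ} (ht : 0 < t) :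
    IntegrableOn (fun σ : ℝ => t ^ (σ - 1 / 2) / Real.Gamma (1 / 2 + σ)) (Ioi 0) := by
  have hcont : Continuous (fun σ : ℝ => t ^ (σ - 1 / 2) / Real.Gamma (1 / 2 + σ)) := by
    simp only [div_eq_mul_inv]
    refine Continuous.mul ?_ (vol_continuous_Gamma_inv.comp (by fun_prop))
    exact Continuous.rpow (by fun_prop) (by fun_prop) (fun _ => Or.inl ht.ne')
  rw [← Ioc_union_Ioi_eq_Ioi (zero_le_one : (0:ℝ) ≤ 1)]
  refine IntegrableOn.union ?_ ?_
  · exact (hcont.integrableOn_Icc).mono_set Ioc_subset_Icc_self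
  · have hi : IntegrableOn (fun x => Real.exp (Real.exp 1 * t) * Real.exp 1 *
        Real.exp (-(1 / 2)) * Real.exp (-1 * x)) (Ioi 1) :=
      Integrable.const_mul (exp_neg_integrableOn_Ioi 1 one_pos) _
    refine Integrable.mono' hi hcont.aestronglyMeasurable ?_
    refine (ae_restrict_iff' measurableSet_Ioi).2 (Eventually.of_forall fun x hx => ?_)
    have hx' : (1:ℝ) < x := hx
    have hG := Real.Gamma_pos_of_pos (by linarith : 0 < 1 / 2 + x)
    rw [Real.norm_of_nonneg (by positivity)]
    have h := vol_decay ht (x := 1 / 2 + x) (by linarith)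
    convert h using 1
    · congr 2; ring
    · have e : -(1 / 2 + x) = -(1 / 2) + -1 * x := by ring
      rw [e, Real.exp_add, mul_assoc _ (Real.exp (-(1/2)))]

lemma vol_log_bound {t : ℝ} (ht : 0 < t) : ∃ C : ℝ, 0 ≤ C ∧ ∀ x ∈ Ioo (0:ℝ) t,
    |-Real.eulerMascheroniConstant - Real.log x| ≤ C * x ^ ((1:ℝ) / 2 - 1) := by
  set g := |Real.eulerMascheroniConstant|
  refine ⟨(g + |Real.log t|) * t ^ ((1:ℝ)/2) + 2, by positivity, fun x hx => ?_⟩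
  have hx0 : 0 < x := hx.1
  have hpos : 0 < x ^ ((1:ℝ) / 2 - 1) := Real.rpow_pos_of_pos hx0 _
  have h1 : 1 ≤ t ^ ((1:ℝ)/2) * x ^ ((1:ℝ) / 2 - 1) := by
    have : (1:ℝ) = x ^ ((1:ℝ)/2) * x ^ ((1:ℝ) / 2 - 1) := by
      rw [← Real.rpow_add hx0]; norm_num
    calc (1:ℝ) = x ^ ((1:ℝ)/2) * x ^ ((1:ℝ) / 2 - 1) := this
      _ ≤ _ := by
        have := hx.2.le
        gcongr
  have h2 : -Real.log x ≤ 2 * x ^ ((1:ℝ) / 2 - 1) := by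
    have := Real.log_le_rpow_div (x := x⁻¹) (ε := 1/2) (by positivity) (by norm_num)
    rw [Real.log_inv, Real.inv_rpow hx0.le, ← Real.rpow_neg hx0.le] at this
    have e : (1:ℝ)/2 - 1 = -(1/2) := by norm_num
    rw [e]; linarith
  have h3 : Real.log x ≤ Real.log t := Real.log_le_log hx0 hx.2.le
  have h4 := le_abs_self (Real.log t)
  have h5 := le_abs_self Real.eulerMascheroniConstant
  have h6 := neg_abs_le Real.eulerMascheroniConstant
  have h7 := mul_le_mul_of_nonneg_left h1 (by positivity : 0 ≤ g + |Real.log t|)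
  have h8 := abs_nonneg (Real.log t)
  rw [abs_le]
  constructor <;> nlinarith

lemma vol_measurable (t : ℝ) : Measurable fun p : ℝ × ℝ =>
    (t - p.2) ^ (p.1 - 1) / Real.Gamma p.1 := by
  have h := (vol_continuous_Gamma_inv.measurable.comp (measurable_fst : Measurable (Prod.fst : ℝ × ℝ → ℝ)))
  simp only [div_eq_mul_inv]
  refine Measurable.mul ?_ h
  exact Measurable.pow (by fun_prop) (by fun_prop)

lemma vol_integrable_prod {t : ℝ} (ht : 0 < t) :
    Integrable (Function.uncurry fun σ x : ℝ => (t - x) ^ (σ - 1) / Real.Gamma σ *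
        (-Real.eulerMascheroniConstant - Real.log x))
      ((volume.restrict (Ioi (0:ℝ))).prod (volume.restrict (Ioo (0:ℝ) t))) := by
  obtain ⟨C, hC0, hC⟩ := vol_log_bound ht
  have hmem : ∀ᵐ p ∂((volume.restrict (Ioi (0:ℝ))).prod (volume.restrict (Ioo (0:ℝ) t))),
      p ∈ Ioi (0:ℝ) ×ˢ Ioo (0:ℝ) t := by
    rw [Measure.prod_restrict]
    exact ae_restrict_mem (measurableSet_Ioi.prod measurableSet_Ioo)
  have hK : Integrable (fun p : ℝ × ℝ => (t - p.2) ^ (p.1 - 1) / Real.Gamma p.1 *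
        (C * p.2 ^ ((1:ℝ) / 2 - 1)))
      ((volume.restrict (Ioi (0:ℝ))).prod (volume.restrict (Ioo (0:ℝ) t))) := by
    have hm : Measurable (fun p : ℝ × ℝ => (t - p.2) ^ (p.1 - 1) / Real.Gamma p.1 *
        (C * p.2 ^ ((1:ℝ) / 2 - 1))) := by
      refine (vol_measurable t).mul (Measurable.const_mul ?_ _)
      exact Measurable.pow measurable_snd measurable_const
    rw [integrable_prod_iff hm.aestronglyMeasurable]
    constructor
    · refine (ae_restrict_iff' measurableSet_Ioi).2 (Eventually.of_forall fun σ hσ => ?_)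
      have := (vol_beta_integrable ht (by norm_num : (0:ℝ) < 1/2) hσ).const_mul
        (C / Real.Gamma σ)
      refine this.congr (Eventually.of_forall fun x => ?_)
      simp only; ring
    · have := (vol_integrable_half ht).const_mul (C * Real.Gamma (1/2))
      refine this.congr ((ae_restrict_iff' measurableSet_Ioi).2
        (Eventually.of_forall fun σ hσ => ?_))
      have hσ' : (0:ℝ) < σ := hσ
      have hG := Real.Gamma_pos_of_pos hσ'
      have e : ∫ x in Ioo (0:ℝ) t, ‖(t - x) ^ (σ - 1) / Real.Gamma σ *
          (C * x ^ ((1:ℝ) / 2 - 1))‖ = ∫ x in Ioo (0:ℝ) t, (C / Real.Gamma σ) *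
            (x ^ ((1:ℝ)/2 - 1) * (t - x) ^ (σ - 1)) := by
        refine setIntegral_congr_fun measurableSet_Ioo fun x hx => ?_
        have h0 : 0 < t - x := by linarith [hx.2]
        have h1 : 0 < x := hx.1
        rw [Real.norm_of_nonneg (by positivity)]
        ring
      simp only
      rw [e, integral_const_mul, vol_beta_real ht (by norm_num) hσ']
      have : (1:ℝ)/2 + σ - 1 = σ - 1/2 := by ring
      rw [this]
      field_simp
  refine hK.mono' ?_ ?_
  · refine Measurable.aestronglyMeasurable ?_
    refine (vol_measurable t).mul (Measurable.sub measurable_const ?_)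
    exact Real.measurable_log.comp measurable_snd
  · filter_upwards [hmem] with p hp
    have h0 : 0 < t - p.2 := by linarith [hp.2.2]
    have h1 : 0 < p.1 := hp.1
    have hG := Real.Gamma_pos_of_pos h1
    simp only [Function.uncurry]
    rw [norm_mul, Real.norm_of_nonneg (by positivity), Real.norm_eq_abs]
    have := hC p.2 hp.2
    gcongr

/-- the primitive -/
noncomputable def volG (t : ℝ) (s : ℂ) : ℂ := (t:ℂ) ^ s * (Complex.Gamma (s + 1))⁻¹

lemma volG_diff {t : ℝ} (ht : 0 < t) : Differentiable ℂ (volG t) := by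
  have h1 : (t:ℂ) ≠ 0 := by exact_mod_cast ht.ne'
  intro s
  refine DifferentiableAt.mul ?_ ?_
  · exact differentiableAt_id.const_cpow (Or.inl h1)
  · exact DifferentiableAt.fun_comp' (f := fun s : ℂ => s + 1) s
      (Complex.differentiable_one_div_Gamma (s + 1)) (by fun_prop)

lemma vol_inner {t : ℝ} (ht : 0 < t) {b : ℝ} (hb : 0 < b) :
    ((∫ x in Ioo (0:ℝ) t, (t - x) ^ (b - 1) / Real.Gamma b *
        (-Real.eulerMascheroniConstant - Real.log x) : ℝ) : ℂ) = - deriv (volG t) b := by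
  set f : ℝ → ℂ := (Ioo (0:ℝ) t).indicator fun x => (((t - x) ^ (b - 1) : ℝ) : ℂ) with hf
  have hbase : IntegrableOn (fun x => (t - x) ^ (b - 1)) (Ioo (0:ℝ) t) := by
    simpa using vol_beta_integrable ht one_pos hb
  have hfint : Integrable f := by
    rw [hf, integrable_indicator_iff measurableSet_Ioo]
    exact hbase.ofReal
  have hmel : ∀ (h : ℝ → ℂ) (s : ℂ), mellin (fun x => h x * f x) s =
      ∫ x in Ioo (0:ℝ) t, (x:ℂ) ^ (s - 1) * (h x * (((t - x) ^ (b - 1) : ℝ) : ℂ)) := by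
    intro h s
    rw [mellin]
    rw [← integral_indicator measurableSet_Ioi, ← integral_indicator measurableSet_Ioo]
    congr 1
    ext x
    by_cases hx : x ∈ Ioo (0:ℝ) t
    · have : x ∈ Ioi (0:ℝ) := hx.1
      rw [indicator_of_mem hx, indicator_of_mem this, hf]
      rw [indicator_of_mem hx]
      simp
    · rw [indicator_of_notMem hx]
      by_cases hx' : x ∈ Ioi (0:ℝ)
      · rw [indicator_of_mem hx', hf]
        rw [indicator_of_notMem hx]; simp
      · rw [indicator_of_notMem hx']
  have hO0 : f =O[𝓝[>] 0] fun x => x ^ (-(0:ℝ)) := by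
    have hc : Tendsto f (𝓝[>] 0) (𝓝 (((t - 0) ^ (b - 1) : ℝ) : ℂ)) := by
      have h1 : ContinuousAt (fun x : ℝ => (((t - x) ^ (b - 1) : ℝ) : ℂ)) 0 := by
        refine Complex.continuous_ofReal.continuousAt.comp ?_
        exact ContinuousAt.rpow_const (by fun_prop) (Or.inl (by simpa using ht.ne'))
      refine (h1.tendsto.mono_left nhdsWithin_le_nhds).congr' ?_
      filter_upwards [Ioo_mem_nhdsGT ht] with x hx
      rw [hf, indicator_of_mem hx]
    simpa using hc.isBigO_one ℝ
  have hOt : f =O[atTop] fun x => x ^ (-(2:ℝ)) := by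
    have : f =ᶠ[atTop] fun _ => 0 := by
      filter_upwards [eventually_ge_atTop t] with x hx
      rw [hf, indicator_of_notMem]
      exact fun h => absurd h.2 (not_lt.2 hx)
    exact this.trans_isBigO (Asymptotics.isBigO_zero _ _)
  obtain ⟨hconv, hder⟩ := mellin_hasDerivAt_of_isBigO_rpow (s := 1)
    (hfint.locallyIntegrable.locallyIntegrableOn _) hOt (by norm_num) hO0 (by norm_num)
  have hGb : Complex.Gamma b ≠ 0 := Complex.Gamma_ne_zero_of_re_pos (by simpa using hb)
  have hform : mellin f =ᶠ[𝓝 1] fun s => Complex.Gamma b * (Complex.Gamma s * volG t (s + (b - 1))) := by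
    have : {s : ℂ | 0 < s.re} ∈ 𝓝 (1:ℂ) :=
      (isOpen_lt continuous_const Complex.continuous_re).mem_nhds (by simp)
    filter_upwards [this] with s hs
    have h1 := hmel (fun _ => 1) s
    simp only [one_mul] at h1
    rw [show mellin f s = _ from h1, vol_beta_complex ht hs hb, volG]
    have e1 : s + (b:ℂ) - 1 = s + (b - 1) := by ring
    have e2 : s + ((b:ℂ) - 1) + 1 = s + b := by ring
    rw [e1, e2]; ring
  have hder2 : HasDerivAt (mellin f) (Complex.Gamma b *
      (-Real.eulerMascheroniConstant * volG t b + deriv (volG t) b)) 1 := by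
    refine HasDerivAt.congr_of_eventuallyEq ?_ hform
    refine HasDerivAt.const_mul _ ?_
    have hg : HasDerivAt (fun s : ℂ => volG t (s + (b - 1))) (deriv (volG t) b) 1 := by
      have := ((volG_diff ht) (1 + ((b:ℂ) - 1))).hasDerivAt.comp_add_const 1 ((b:ℂ) - 1)
      simpa using this
    have := Complex.hasDerivAt_Gamma_one.fun_mul hg
    simpa [Complex.Gamma_one] using this
  have heq := hder.unique hder2
  -- log integral
  have hlog : mellin (fun x => Real.log x • f x) 1 =
      ∫ x in Ioo (0:ℝ) t, ((Real.log x * (t - x) ^ (b - 1) : ℝ) : ℂ) := by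
    have := hmel (fun x => ((Real.log x : ℝ) : ℂ)) 1
    simp only [Complex.real_smul]
    rw [this]
    simp
  have hone : ∫ x in Ioo (0:ℝ) t, (((t - x) ^ (b - 1) : ℝ) : ℂ) = Complex.Gamma b * volG t b := by
    have := vol_beta_complex ht (s := 1) (by simp) hb
    simp only [sub_self, Complex.cpow_zero, one_mul, Complex.Gamma_one] at this
    rw [this, volG, add_comm (1:ℂ)]
    rw [add_sub_cancel_right]; ring
  rw [hlog, integral_complex_ofReal] at heq
  rw [integral_complex_ofReal] at hone
  have hlogint : IntegrableOn (fun x => Real.log x * (t - x) ^ (b - 1)) (Ioo (0:ℝ) t) := by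
    obtain ⟨C, hC0, hC⟩ := vol_log_bound ht
    have h1 := (vol_beta_integrable ht (by norm_num : (0:ℝ) < 1/2) hb).const_mul C
    have h2 : IntegrableOn (fun x => (-Real.eulerMascheroniConstant - Real.log x) *
        (t - x) ^ (b - 1)) (Ioo (0:ℝ) t) := by
      refine h1.mono' ?_ ?_
      · refine Measurable.aestronglyMeasurable ?_
        refine Measurable.mul (Measurable.sub measurable_const Real.measurable_log) ?_
        exact Measurable.pow (by fun_prop) (by fun_prop)
      · refine (ae_restrict_iff' measurableSet_Ioo).2 (Eventually.of_forall fun x hx => ?_)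
        have h0 : 0 < t - x := by linarith [hx.2]
        have hp : 0 < (t - x) ^ (b - 1) := Real.rpow_pos_of_pos h0 _
        rw [norm_mul, Real.norm_of_nonneg hp.le, Real.norm_eq_abs, ← mul_assoc]
        have := hC x hx
        gcongr
    have h3 := (hbase.const_mul (-Real.eulerMascheroniConstant)).sub h2
    refine h3.congr (Eventually.of_forall fun x => ?_)
    simp only [Pi.sub_apply]
    ring
  have hfin : ∫ x in Ioo (0:ℝ) t, (t - x) ^ (b - 1) / Real.Gamma b *
        (-Real.eulerMascheroniConstant - Real.log x) =
      (Real.Gamma b)⁻¹ * (-Real.eulerMascheroniConstant * (∫ x in Ioo (0:ℝ) t, (t - x) ^ (b - 1))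
        - ∫ x in Ioo (0:ℝ) t, Real.log x * (t - x) ^ (b - 1)) := by
    rw [← integral_const_mul (-Real.eulerMascheroniConstant),
      ← integral_sub (hbase.const_mul _) hlogint, ← integral_const_mul]
    congr 1
    ext x
    ring
  rw [hfin]
  push_cast [-Complex.ofReal_neg] at heq hone ⊢
  rw [heq, hone, ← Complex.Gamma_ofReal]
  push_cast
  field_simp
  ring

lemma volG_tendsto {t : ℝ} (ht : 0 < t) : Tendsto (fun σ : ℝ => volG t σ) atTop (𝓝 0) := by
  have h : Tendsto (fun x : ℝ => Real.exp (Real.exp 1 * t) * Real.exp 1 * Real.exp (-(x + 1)))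
      atTop (𝓝 0) := by
    have h1 : Tendsto (fun x : ℝ => Real.exp (-(x + 1))) atTop (𝓝 0) :=
      Real.tendsto_exp_neg_atTop_nhds_zero.comp (tendsto_atTop_add_const_right _ 1 tendsto_id)
    simpa using h1.const_mul (Real.exp (Real.exp 1 * t) * Real.exp 1)
  refine squeeze_zero_norm' ?_ h
  filter_upwards [eventually_ge_atTop (0:ℝ)] with x hx
  have hd := vol_decay ht (x := x + 1) (by linarith)
  have hG := Real.Gamma_pos_of_pos (by linarith : 0 < x + 1)
  refine le_trans (le_of_eq ?_) hd
  have e : volG t x = ((t ^ x / Real.Gamma (x + 1) : ℝ) : ℂ) := by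
    rw [volG, div_eq_mul_inv]
    push_cast
    rw [Complex.ofReal_cpow ht.le, ← Complex.Gamma_ofReal]
    push_cast
    rfl
  rw [e, Complex.norm_real, Real.norm_of_nonneg (by positivity)]
  congr 2; ring

/-- For every `t > 0`, the function `τ ↦ I(t-τ)·(-γ - log τ)` is integrable on `(0,t)`
and `∫₀ᵗ I(t-τ)·(-γ - log τ) dτ = 1`, `γ` being the Euler–Mascheroni constant. -/
theorem volterraI_inverse_log_kernel (t : ℝ) (ht : 0 < t) :
    IntegrableOn
      (fun τ => volterraI (t - τ) * (-Real.eulerMascheroniConstant - Real.log τ))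
      (Set.Ioo 0 t) volume ∧
    ∫ τ in Set.Ioo (0 : ℝ) t,
      volterraI (t - τ) * (-Real.eulerMascheroniConstant - Real.log τ) = 1 := by
  have hprod := vol_integrable_prod ht
  have hinner : ∀ τ : ℝ, ∫ σ in Ioi (0:ℝ), (t - τ) ^ (σ - 1) / Real.Gamma σ *
      (-Real.eulerMascheroniConstant - Real.log τ) =
      volterraI (t - τ) * (-Real.eulerMascheroniConstant - Real.log τ) := by
    intro τ
    rw [integral_mul_const, volterraI]
  constructor
  · have := hprod.integral_prod_right
    simp only [Function.uncurry, hinner] at this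
    exact this
  · have hswap := integral_integral_swap hprod
    simp only [hinner] at hswap
    rw [← hswap]
    apply Complex.ofReal_injective
    rw [← integral_complex_ofReal]
    have hint := hprod.integral_prod_left
    simp only [Function.uncurry] at hint
    have hint' := hint.ofReal (𝕜 := ℂ)
    have hc : ∀ σ ∈ Ioi (0:ℝ), ((∫ x in Ioo (0:ℝ) t, (t - x) ^ (σ - 1) / Real.Gamma σ *
        (-Real.eulerMascheroniConstant - Real.log x) : ℝ) : ℂ) = - deriv (volG t) σ :=
      fun σ hσ => vol_inner ht hσ
    have hcI : IntegrableOn (fun σ : ℝ => - deriv (volG t) σ) (Ioi 0) :=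
      IntegrableOn.congr_fun hint' hc measurableSet_Ioi
    refine (setIntegral_congr_fun measurableSet_Ioi hc).trans ?_
    have hd : ∀ x : ℝ, HasDerivAt (fun y : ℝ => - volG t y) (- deriv (volG t) x) x :=
      fun x => ((volG_diff ht) (x:ℂ)).hasDerivAt.comp_ofReal.neg
    rw [integral_Ioi_of_hasDerivAt_of_tendsto (hd 0).continuousAt.continuousWithinAt
      (fun x _ => hd x) hcI (volG_tendsto ht).neg]
    simp [volG]
end

section
/- For every t > 0 and every function f that is Lebesgue integrable on (0, t), one has ∫₀ᵗ I(t−τ) · ( ∫₀^τ (−γ − log(τ−σ)) f(σ) dσ ) dτ = ∫₀ᵗ f(σ) dσ, where γ is the Euler–Mascheroni constant. (In operator form: I J f = ∫₀ᵗ f, where (I g)(t) = ∫₀ᵗ I(t−τ) g(τ) dτ and (J f)(τ) = ∫₀^τ (−γ − log(τ−σ)) f(σ) dσ.) -/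
open MeasureTheory Real

lemma vc_cont_invGamma : Continuous (fun x : ℝ => (Real.Gamma x)⁻¹) := by
  have h : Continuous (fun x : ℝ => ((Complex.Gamma (x : ℂ))⁻¹).re) :=
    Complex.continuous_re.comp
      (Complex.differentiable_one_div_Gamma.continuous.comp Complex.continuous_ofReal)
  convert h using 2 with x
  rw [Complex.Gamma_ofReal, ← Complex.ofReal_inv, Complex.ofReal_re]

lemma vc_meas : Measurable (fun p : ℝ × ℝ => p.1 ^ (p.2 - 1) / Real.Gamma p.2) := by
  simp only [div_eq_mul_inv]
  exact (measurable_fst.pow (measurable_snd.sub_const 1)).mul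
    (vc_cont_invGamma.measurable.comp measurable_snd)

lemma vc_measI : Measurable volterraI := by
  have h := (vc_meas.stronglyMeasurable).integral_prod_right'
    (ν := volume.restrict (Set.Ioi (0:ℝ)))
  exact h.measurable

lemma vc_nonnegI (t : ℝ) (ht : 0 ≤ t) : 0 ≤ volterraI t := by
  refine setIntegral_nonneg measurableSet_Ioi fun x hx => ?_
  exact div_nonneg (Real.rpow_nonneg ht _) (Real.Gamma_pos_of_pos hx).le

lemma vc_cont (s : ℝ) (hs : 0 < s) : Continuous (fun x : ℝ => s ^ (x - 1) / Real.Gamma x) := by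
  simp only [div_eq_mul_inv]
  exact ((continuous_const).rpow (continuous_id.sub continuous_const)
    (fun _ => Or.inl hs.ne')).mul vc_cont_invGamma

lemma vc_Gamma_lower (A x : ℝ) (hA : 0 < A) (hx : 1 ≤ x) :
    A ^ (x - 1) * Real.exp (-A) ≤ Real.Gamma x := by
  have hx0 : 0 < x := by linarith
  rw [Real.Gamma_eq_integral hx0]
  have hint := Real.GammaIntegral_convergent hx0
  calc A ^ (x - 1) * Real.exp (-A) = ∫ y in Set.Ioi A, Real.exp (-y) * A ^ (x - 1) := by
        rw [integral_mul_const, integral_exp_neg_Ioi, mul_comm]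
    _ ≤ ∫ y in Set.Ioi A, Real.exp (-y) * y ^ (x - 1) := by
        refine setIntegral_mono_on ((integrableOn_exp_neg_Ioi A).mul_const _)
          (hint.mono_set (Set.Ioi_subset_Ioi hA.le)) measurableSet_Ioi fun y hy => ?_
        have hy : A < y := hy
        gcongr
    _ ≤ ∫ y in Set.Ioi 0, Real.exp (-y) * y ^ (x - 1) := by
        refine setIntegral_mono_set hint ?_ (Set.Ioi_subset_Ioi hA.le).eventuallyLE
        refine (ae_restrict_iff' measurableSet_Ioi).2 (Filter.Eventually.of_forall fun y hy => ?_)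
        have hy : 0 < y := hy
        positivity

lemma vc_int (s : ℝ) (hs : 0 < s) :
    IntegrableOn (fun x : ℝ => s ^ (x - 1) / Real.Gamma x) (Set.Ioi 0) := by
  rw [← Set.Ioc_union_Ioi_eq_Ioi (zero_le_one (α := ℝ)), integrableOn_union]
  refine ⟨(vc_cont s hs).integrableOn_Ioc, ?_⟩
  refine Integrable.mono' ((integrableOn_exp_neg_Ioi 1).const_mul
    (Real.exp (s * Real.exp 1 + 1))) (vc_cont s hs).aestronglyMeasurable ?_
  refine (ae_restrict_iff' measurableSet_Ioi).2 (Filter.Eventually.of_forall fun x hx => ?_)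
  have hx : 1 < x := hx
  have hG := Real.Gamma_pos_of_pos (show 0 < x by linarith)
  have hL := vc_Gamma_lower (s * Real.exp 1) x (by positivity) hx.le
  rw [Real.norm_of_nonneg (by positivity), div_le_iff₀ hG]
  calc s ^ (x - 1) = Real.exp (s * Real.exp 1 + 1) * Real.exp (-x) *
        ((s * Real.exp 1) ^ (x - 1) * Real.exp (-(s * Real.exp 1))) := by
        rw [Real.mul_rpow hs.le (Real.exp_pos 1).le, ← Real.exp_mul]
        have : Real.exp (s * Real.exp 1 + 1) * Real.exp (-x) * Real.exp (1 * (x-1)) *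
            Real.exp (-(s * Real.exp 1)) = 1 := by
          rw [← Real.exp_add, ← Real.exp_add, ← Real.exp_add]
          convert Real.exp_zero using 2
          ring
        linear_combination (-s ^ (x - 1)) * this
    _ ≤ _ := by gcongr

lemma vc_beta (s x a : ℝ) (hs : 0 < s) (hx : 0 < x) (ha : 0 < a) :
    ∫ u in Set.Ioo 0 s, (s - u) ^ (x - 1) * u ^ (a - 1) =
      s ^ (x + a - 1) * (Real.Gamma x * Real.Gamma a / Real.Gamma (x + a)) := by
  have h := Complex.betaIntegral_scaled (a : ℂ) (x : ℂ) hs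
  rw [Complex.betaIntegral_eq_Gamma_mul_div _ _ (by simpa) (by simpa),
    intervalIntegral.integral_of_le hs.le, integral_Ioc_eq_integral_Ioo] at h
  have h2 : ∫ u in Set.Ioo 0 s, ((u : ℂ) ^ ((a:ℂ) - 1) * ((s:ℂ) - u) ^ ((x:ℂ) - 1)) =
      ∫ u in Set.Ioo 0 s, (((s - u) ^ (x - 1) * u ^ (a - 1) : ℝ) : ℂ) := by
    refine setIntegral_congr_fun measurableSet_Ioo fun u hu => ?_
    have := hu.1
    have h3 : 0 ≤ s - u := by linarith [hu.2]
    simp only [Complex.ofReal_mul]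
    rw [Complex.ofReal_cpow h3, Complex.ofReal_cpow hu.1.le]
    push_cast
    ring
  rw [h2, integral_complex_ofReal] at h
  have h4 : ((s ^ (x + a - 1) * (Real.Gamma x * Real.Gamma a / Real.Gamma (x + a)) : ℝ) : ℂ) =
      (s:ℂ) ^ ((a:ℂ) + x - 1) * (Complex.Gamma a * Complex.Gamma x / Complex.Gamma (a + x)) := by
    push_cast
    rw [Complex.ofReal_cpow hs.le, ← Complex.ofReal_add, Complex.Gamma_ofReal,
      Complex.Gamma_ofReal, Complex.Gamma_ofReal]
    push_cast
    rw [add_comm x a, add_comm (x:ℂ) a]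
    ring
  rw [← h4] at h
  exact_mod_cast h

lemma vc_beta_int (s x a : ℝ) (hs : 0 < s) (hx : 0 < x) (ha : 0 < a) :
    IntegrableOn (fun u => (s - u) ^ (x - 1) * u ^ (a - 1)) (Set.Ioo 0 s) := by
  by_contra h
  have h1 := integral_undef h
  rw [vc_beta s x a hs hx ha] at h1
  have := Real.Gamma_pos_of_pos hx
  have := Real.Gamma_pos_of_pos ha
  have := Real.Gamma_pos_of_pos (add_pos hx ha)
  exact (show 0 < s ^ (x + a - 1) * (Real.Gamma x * Real.Gamma a / Real.Gamma (x + a)) by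
    positivity).ne' h1

lemma vc_main (s a : ℝ) (hs : 0 < s) (ha : 0 < a) :
    IntegrableOn (fun u => volterraI (s - u) * u ^ (a - 1)) (Set.Ioo 0 s) ∧
    ∫ u in Set.Ioo 0 s, volterraI (s - u) * u ^ (a - 1) =
      Real.Gamma a * ∫ x in Set.Ioi a, s ^ (x - 1) / Real.Gamma x := by
  let F : ℝ → ℝ → ℝ := fun u x => (s - u) ^ (x - 1) / Real.Gamma x * u ^ (a - 1)
  have hFI : ∀ u, ∫ x in Set.Ioi 0, F u x = volterraI (s - u) * u ^ (a - 1) := by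
    intro u
    simp only [F, integral_mul_const, volterraI]
  have hval : ∀ x ∈ Set.Ioi (0:ℝ), ∫ u in Set.Ioo 0 s, F u x =
      Real.Gamma a * (s ^ (x + a - 1) / Real.Gamma (x + a)) := by
    intro x hx
    have hG := Real.Gamma_pos_of_pos hx
    have h1 : ∀ u, F u x = (Real.Gamma x)⁻¹ * ((s - u) ^ (x - 1) * u ^ (a - 1)) := by
      intro u; simp only [F]; ring
    simp only [h1, integral_const_mul]
    rw [vc_beta s x a hs hx ha]
    field_simp
  have hmeasF : Measurable (Function.uncurry F) := by
    refine Measurable.mul (vc_meas.comp ((measurable_const.sub measurable_fst).prodMk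
      measurable_snd)) (measurable_fst.pow_const _)
  have hshift : IntegrableOn (fun x => s ^ (x + a - 1) / Real.Gamma (x + a)) (Set.Ioi 0) := by
    have h := (vc_int s hs).mono_set (Set.Ioi_subset_Ioi ha.le)
    have h2 := ((measurePreserving_add_right volume a).integrableOn_comp_preimage
      (measurableEmbedding_addRight a)).2 h
    rw [Set.preimage_add_const_Ioi, sub_self] at h2
    exact h2
  have hprod : Integrable (Function.uncurry F)
      ((volume.restrict (Set.Ioo 0 s)).prod (volume.restrict (Set.Ioi 0))) := by
    rw [integrable_prod_iff' hmeasF.aestronglyMeasurable]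
    constructor
    · refine (ae_restrict_iff' measurableSet_Ioi).2 (Filter.Eventually.of_forall fun x hx => ?_)
      have h1 : ∀ u, F u x = (Real.Gamma x)⁻¹ * ((s - u) ^ (x - 1) * u ^ (a - 1)) := by
        intro u; simp only [F]; ring
      simp only [Function.uncurry_apply_pair, h1]
      exact (vc_beta_int s x a hs hx ha).const_mul _
    · refine IntegrableOn.congr_fun (hshift.const_mul (Real.Gamma a)) ?_ measurableSet_Ioi
      intro x hx
      simp only
      rw [← hval x hx]
      refine setIntegral_congr_fun measurableSet_Ioo fun u hu => ?_
      have hG := Real.Gamma_pos_of_pos hx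
      have h3 : 0 ≤ s - u := by linarith [hu.2]
      have := hu.1
      exact (Real.norm_of_nonneg (by simp only [F]; positivity)).symm
  constructor
  · have := hprod.integral_prod_left
    simp only [Function.uncurry_apply_pair, hFI] at this
    exact this
  · simp only [← hFI]
    rw [integral_integral_swap hprod, setIntegral_congr_fun measurableSet_Ioi hval,
      integral_const_mul]
    congr 1
    have h2 := (measurePreserving_add_right volume a).setIntegral_preimage_emb
      (measurableEmbedding_addRight a) (fun x => s ^ (x - 1) / Real.Gamma x) (Set.Ioi a)
    rw [Set.preimage_add_const_Ioi, sub_self] at h2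
    exact h2

lemma vc_log_bound (u a : ℝ) (hu : 0 < u) (ha : a ∈ Metric.ball (1:ℝ) (1/4)) :
    |u ^ (a - 1) * Real.log u| ≤
      4 * (u ^ ((3/2:ℝ) - 1) + 2 * u ^ ((1:ℝ) - 1) + u ^ ((1/2:ℝ) - 1)) := by
  rw [Metric.mem_ball, Real.dist_eq, abs_lt] at ha
  have hp : 0 < u ^ (1/4:ℝ) := Real.rpow_pos_of_pos hu _
  have hq : 0 < u ^ (-(1/4):ℝ) := Real.rpow_pos_of_pos hu _
  have hr : 0 < u ^ (a - 1) := Real.rpow_pos_of_pos hu _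
  have h1 : |Real.log u| ≤ 4 * (u ^ (1/4:ℝ) + u ^ (-(1/4):ℝ)) := by
    have e1 := Real.log_le_rpow_div hu.le (show (0:ℝ) < 1/4 by norm_num)
    have e2 := Real.log_le_rpow_div (inv_pos.2 hu).le (show (0:ℝ) < 1/4 by norm_num)
    rw [Real.log_inv, Real.inv_rpow hu.le, ← Real.rpow_neg hu.le] at e2
    rw [abs_le]
    constructor <;> linarith
  have h2 : u ^ (a - 1) ≤ u ^ (1/4:ℝ) + u ^ (-(1/4):ℝ) := by
    rcases le_total 1 u with h | h
    · have := Real.rpow_le_rpow_of_exponent_le h (show a - 1 ≤ 1/4 by linarith)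
      linarith
    · have := Real.rpow_le_rpow_of_exponent_ge hu h (show -(1/4) ≤ a - 1 by linarith)
      linarith
  rw [abs_mul, abs_of_pos hr]
  have e3 : u ^ ((3/2:ℝ) - 1) = u ^ (1/4:ℝ) * u ^ (1/4:ℝ) := by
    rw [← Real.rpow_add hu]; norm_num
  have e4 : u ^ ((1/2:ℝ) - 1) = u ^ (-(1/4):ℝ) * u ^ (-(1/4):ℝ) := by
    rw [← Real.rpow_add hu]; norm_num
  have e5 : u ^ ((1:ℝ) - 1) = u ^ (1/4:ℝ) * u ^ (-(1/4):ℝ) := by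
    rw [← Real.rpow_add hu]; norm_num
  rw [e3, e4, e5]
  calc u ^ (a - 1) * |Real.log u| ≤
      (u ^ (1/4:ℝ) + u ^ (-(1/4):ℝ)) * (4 * (u ^ (1/4:ℝ) + u ^ (-(1/4):ℝ))) := by gcongr
    _ = _ := by ring

lemma vc_deriv_tail (s : ℝ) (hs : 0 < s) :
    HasDerivAt (fun a => Real.Gamma a * ∫ x in Set.Ioi a, s ^ (x - 1) / Real.Gamma x)
      (-Real.eulerMascheroniConstant * (∫ x in Set.Ioi 1, s ^ (x - 1) / Real.Gamma x) - 1) 1 := by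
  have hG : HasDerivAt Real.Gamma (-Real.eulerMascheroniConstant) 1 := by
    rw [Real.eulerMascheroniConstant_eq_neg_deriv, neg_neg]
    refine (Real.differentiableAt_Gamma fun m h => ?_).hasDerivAt
    have : (0:ℝ) ≤ m := m.cast_nonneg
    linarith
  have hc := vc_cont s hs
  have hH0 : HasDerivAt (fun a => (∫ x in Set.Ioi 1, s ^ (x - 1) / Real.Gamma x) -
      ∫ x in (1:ℝ)..a, s ^ (x - 1) / Real.Gamma x) (-1) 1 := by
    have h := (intervalIntegral.integral_hasDerivAt_right (hc.intervalIntegrable 1 1)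
      (hc.stronglyMeasurableAtFilter _ _) hc.continuousAt).const_sub
      (∫ x in Set.Ioi 1, s ^ (x - 1) / Real.Gamma x)
    simpa using h
  have hH : HasDerivAt (fun a => ∫ x in Set.Ioi a, s ^ (x - 1) / Real.Gamma x) (-1) 1 := by
    refine hH0.congr_of_eventuallyEq ?_
    filter_upwards [lt_mem_nhds (show (0:ℝ) < 1 by norm_num)] with a ha
    have := intervalIntegral.integral_interval_add_Ioi
      ((vc_int s hs).mono_set (Set.Ioi_subset_Ioi (zero_le_one)))
      ((vc_int s hs).mono_set (Set.Ioi_subset_Ioi ha.le))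
    linarith
  have h3 := hG.mul hH
  rw [Real.Gamma_one, one_mul, ← sub_eq_add_neg] at h3
  exact h3

lemma vc_kernel (s : ℝ) (hs : 0 < s) :
    IntegrableOn (fun u => volterraI (s - u) * (-Real.eulerMascheroniConstant - Real.log u))
      (Set.Ioo 0 s) ∧
    ∫ u in Set.Ioo 0 s, volterraI (s - u) * (-Real.eulerMascheroniConstant - Real.log u) = 1 := by
  have hmI : Measurable (fun u => volterraI (s - u)) :=
    vc_measI.comp (measurable_const.sub measurable_id)
  have hD := hasDerivAt_integral_of_dominated_loc_of_deriv_le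
    (μ := volume.restrict (Set.Ioo 0 s)) (x₀ := (1:ℝ)) (s := Metric.ball (1:ℝ) (1/4))
    (F := fun a u => volterraI (s - u) * u ^ (a - 1))
    (F' := fun a u => volterraI (s - u) * (u ^ (a - 1) * Real.log u))
    (bound := fun u => 4 * (volterraI (s - u) * u ^ ((3/2:ℝ) - 1) +
      2 * (volterraI (s - u) * u ^ ((1:ℝ) - 1)) + volterraI (s - u) * u ^ ((1/2:ℝ) - 1)))
    (Metric.ball_mem_nhds _ (by norm_num))
    (Filter.Eventually.of_forall fun a =>
      (hmI.mul (measurable_id.pow_const _)).aestronglyMeasurable)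
    (vc_main s 1 hs one_pos).1
    ((hmI.mul ((measurable_id.pow_const _).mul Real.measurable_log)).aestronglyMeasurable)
    ?_ ?_ ?_
  · obtain ⟨hi, hd⟩ := hD
    simp only [sub_self, Real.rpow_zero, one_mul] at hi hd
    have h1 := (vc_main s 1 hs one_pos)
    simp only [sub_self, Real.rpow_zero, mul_one, Real.Gamma_one, one_mul] at h1
    have hd2 := (vc_deriv_tail s hs).congr_of_eventuallyEq
      (f₁ := fun a : ℝ => ∫ u in Set.Ioo 0 s, volterraI (s - u) * u ^ (a - 1)) (by
        filter_upwards [lt_mem_nhds (show (0:ℝ) < 1 by norm_num)] with a ha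
        exact (vc_main s a hs ha).2)
    have he := hd.unique hd2
    have hfun : (fun u => volterraI (s - u) * (-Real.eulerMascheroniConstant - Real.log u)) =
        fun u => -Real.eulerMascheroniConstant * volterraI (s - u) -
          volterraI (s - u) * Real.log u := by
      ext u; ring
    rw [hfun]
    refine ⟨(h1.1.const_mul _).sub hi, ?_⟩
    rw [integral_sub (h1.1.const_mul _) hi, integral_const_mul, h1.2, he]
    ring
  · refine (ae_restrict_iff' measurableSet_Ioo).2 (Filter.Eventually.of_forall fun u hu a ha => ?_)
    have hI := vc_nonnegI (s - u) (by linarith [hu.2])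
    rw [norm_mul, Real.norm_of_nonneg hI, Real.norm_eq_abs]
    have := mul_le_mul_of_nonneg_left (vc_log_bound u a hu.1 ha) hI
    linarith
  · exact (((vc_main s _ hs (by norm_num)).1.add
      ((vc_main s _ hs (by norm_num)).1.const_mul 2)).add
      (vc_main s _ hs (by norm_num)).1).const_mul 4
  · refine (ae_restrict_iff' measurableSet_Ioo).2 (Filter.Eventually.of_forall fun u hu a ha => ?_)
    have h := (((hasDerivAt_id a).sub_const 1).const_rpow hu.1).const_mul (volterraI (s - u))
    refine h.congr_deriv ?_
    simp only [id]
    ring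

lemma vc_kernel_abs (t : ℝ) : ∃ M : ℝ, ∀ s, 0 < s → s ≤ t →
    ∫ u in Set.Ioo 0 s,
      |volterraI (s - u) * (-Real.eulerMascheroniConstant - Real.log u)| ≤ M := by
  refine ⟨1 + 2 * |Real.eulerMascheroniConstant + Real.log t| *
    ∫ x in Set.Ioi 1, t ^ (x - 1) / Real.Gamma x, fun s hs hst => ?_⟩
  have hk := vc_kernel s hs
  have h1 := (vc_main s 1 hs one_pos)
  simp only [sub_self, Real.rpow_zero, mul_one, Real.Gamma_one, one_mul] at h1
  have ht := hs.trans_le hst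
  have hle : ∫ x in Set.Ioi 1, s ^ (x - 1) / Real.Gamma x ≤
      ∫ x in Set.Ioi 1, t ^ (x - 1) / Real.Gamma x := by
    refine setIntegral_mono_on ((vc_int s hs).mono_set (Set.Ioi_subset_Ioi (zero_le_one)))
      ((vc_int t ht).mono_set (Set.Ioi_subset_Ioi (zero_le_one))) measurableSet_Ioi fun x hx => ?_
    have hx : 1 < x := hx
    have hG := Real.Gamma_pos_of_pos (show 0 < x by linarith)
    have := Real.rpow_le_rpow hs.le hst (show 0 ≤ x - 1 by linarith)
    gcongr
  calc _ ≤ ∫ u in Set.Ioo 0 s,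
      (volterraI (s - u) * (-Real.eulerMascheroniConstant - Real.log u) +
        2 * |Real.eulerMascheroniConstant + Real.log t| * volterraI (s - u)) := by
        refine setIntegral_mono_on hk.1.norm (hk.1.add (h1.1.const_mul _)) measurableSet_Ioo
          fun u hu => ?_
        have hI := vc_nonnegI (s - u) (by linarith [hu.2])
        rw [abs_mul, abs_of_nonneg hI]
        have hl := Real.log_le_log hu.1 (show u ≤ t by linarith [hu.2])
        have hle := le_abs_self (Real.eulerMascheroniConstant + Real.log t)
        have h0 := abs_nonneg (Real.eulerMascheroniConstant + Real.log t)
        have : |-Real.eulerMascheroniConstant - Real.log u| ≤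
            (-Real.eulerMascheroniConstant - Real.log u) +
            2 * |Real.eulerMascheroniConstant + Real.log t| := by
          rw [abs_le]
          constructor <;> linarith
        have := mul_le_mul_of_nonneg_left this hI
        linarith
    _ = 1 + 2 * |Real.eulerMascheroniConstant + Real.log t| *
        ∫ x in Set.Ioi 1, s ^ (x - 1) / Real.Gamma x := by
        rw [integral_add hk.1 (h1.1.const_mul _), hk.2, integral_const_mul, h1.2]
    _ ≤ _ := by gcongr

lemma vc_shift (t σ : ℝ) (hσ : 0 ≤ σ) (φ : ℝ → ℝ) :
    ∫ τ in Set.Ioo 0 t, (if σ < τ then φ (τ - σ) else 0) = ∫ u in Set.Ioo 0 (t - σ), φ u := by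
  have h2 := (measurePreserving_sub_right volume σ).setIntegral_preimage_emb
      (MeasurableEquiv.subRight σ).measurableEmbedding φ (Set.Ioo 0 (t - σ))
  rw [← h2]
  have : (fun τ => if σ < τ then φ (τ - σ) else 0) =
      (Set.Ioi σ).indicator (fun τ => φ (τ - σ)) := by
    ext τ; simp [Set.indicator_apply]
  rw [this, setIntegral_indicator measurableSet_Ioi]
  congr 2
  ext τ
  simp only [Set.mem_inter_iff, Set.mem_Ioo, Set.mem_Ioi, Set.mem_preimage]
  constructor
  · rintro ⟨⟨a, b⟩, c⟩; constructor <;> linarith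
  · rintro ⟨a, b⟩; refine ⟨⟨?_, ?_⟩, ?_⟩ <;> linarith

lemma vc_shift_int (t σ : ℝ) (φ : ℝ → ℝ)
    (h : IntegrableOn φ (Set.Ioo 0 (t - σ))) :
    IntegrableOn (fun τ => if σ < τ then φ (τ - σ) else 0) (Set.Ioo 0 t) := by
  have h2 := ((measurePreserving_sub_right volume σ).integrableOn_comp_preimage
      (MeasurableEquiv.subRight σ).measurableEmbedding).2 h
  have : (fun τ => if σ < τ then φ (τ - σ) else 0) =
      (Set.Ioi σ).indicator (fun τ => φ (τ - σ)) := by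
    ext τ; simp [Set.indicator_apply]
  rw [this]
  refine IntegrableOn.integrable_indicator ?_ measurableSet_Ioi
  rw [IntegrableOn, Measure.restrict_restrict measurableSet_Ioi]
  refine IntegrableOn.mono_set h2 ?_
  rintro τ ⟨c, a, b⟩
  have c : σ < τ := c
  constructor <;> linarith

/-- For every `t > 0` and every `f` integrable on `(0,t)`, one has `I J f = ∫₀ᵗ f`,
where `(I g)(t) = ∫₀ᵗ I(t-τ) g(τ) dτ` and
`(J f)(τ) = ∫₀^τ (-γ - log(τ-σ)) f(σ) dσ`. -/
theorem volterraI_comp_log_kernel (t : ℝ) (ht : 0 < t) (f : ℝ → ℂ)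
    (hf : IntegrableOn f (Set.Ioo 0 t) volume) :
    ∫ τ in Set.Ioo (0 : ℝ) t,
        (volterraI (t - τ) : ℂ) *
          ∫ σ in Set.Ioo (0 : ℝ) τ,
            ((-Real.eulerMascheroniConstant - Real.log (τ - σ) : ℝ) : ℂ) * f σ
      = ∫ σ in Set.Ioo (0 : ℝ) t, f σ := by
  let g : ℝ → ℝ → ℝ := fun τ σ => if σ < τ then
    volterraI (t - τ) * (-Real.eulerMascheroniConstant - Real.log (τ - σ)) else 0
  have hmg : Measurable (Function.uncurry g) := by
    refine Measurable.ite (measurableSet_lt measurable_snd measurable_fst) ?_ measurable_const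
    exact (vc_measI.comp (measurable_const.sub measurable_fst)).mul
      (measurable_const.sub (Real.measurable_log.comp (measurable_fst.sub measurable_snd)))
  have hg : ∀ σ τ, g τ σ = if σ < τ then (fun u => volterraI ((t - σ) - u) *
      (-Real.eulerMascheroniConstant - Real.log u)) (τ - σ) else 0 := by
    intro σ τ
    simp only [g, sub_sub_sub_cancel_right]
  have hgabs : ∀ σ τ, |g τ σ| = if σ < τ then (fun u => |volterraI ((t - σ) - u) *
      (-Real.eulerMascheroniConstant - Real.log u)|) (τ - σ) else 0 := by
    intro σ τ
    rw [hg]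
    split_ifs <;> simp
  have hgi : ∀ σ ∈ Set.Ioo 0 t, IntegrableOn (fun τ => g τ σ) (Set.Ioo 0 t) := by
    intro σ hσ
    simp only [hg]
    exact vc_shift_int t σ _ (vc_kernel (t - σ) (by linarith [hσ.2])).1
  have hg1 : ∀ σ ∈ Set.Ioo 0 t, ∫ τ in Set.Ioo 0 t, g τ σ = 1 := by
    intro σ hσ
    simp only [hg]
    rw [← (vc_kernel (t - σ) (by linarith [hσ.2])).2]
    exact vc_shift t σ hσ.1.le
      (fun u => volterraI ((t - σ) - u) * (-Real.eulerMascheroniConstant - Real.log u))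
  obtain ⟨M, hM⟩ := vc_kernel_abs t
  have hgM : ∀ σ ∈ Set.Ioo 0 t, ∫ τ in Set.Ioo 0 t, |g τ σ| ≤ M := by
    intro σ hσ
    simp only [hgabs]
    refine le_trans (le_of_eq ?_) (hM (t - σ) (by linarith [hσ.2]) (by linarith [hσ.1]))
    exact vc_shift t σ hσ.1.le
      (fun u => |volterraI ((t - σ) - u) * (-Real.eulerMascheroniConstant - Real.log u)|)
  let F : ℝ → ℝ → ℂ := fun τ σ => (g τ σ : ℂ) * f σ
  have hmF : AEStronglyMeasurable (Function.uncurry F)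
      ((volume.restrict (Set.Ioo 0 t)).prod (volume.restrict (Set.Ioo 0 t))) := by
    have h1 : AEStronglyMeasurable (fun p : ℝ × ℝ => ((Function.uncurry g p : ℝ) : ℂ))
      ((volume.restrict (Set.Ioo 0 t)).prod (volume.restrict (Set.Ioo 0 t))) :=
      (Complex.measurable_ofReal.comp hmg).aestronglyMeasurable
    exact h1.mul hf.aestronglyMeasurable.comp_snd
  have hprod : Integrable (Function.uncurry F)
      ((volume.restrict (Set.Ioo 0 t)).prod (volume.restrict (Set.Ioo 0 t))) := by
    rw [integrable_prod_iff' hmF]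
    constructor
    · refine (ae_restrict_iff' measurableSet_Ioo).2 (Filter.Eventually.of_forall fun σ hσ => ?_)
      exact ((hgi σ hσ).ofReal (𝕜 := ℂ)).mul_const (f σ)
    · refine Integrable.mono' (hf.norm.const_mul M) hmF.norm.prod_swap.integral_prod_right' ?_
      refine (ae_restrict_iff' measurableSet_Ioo).2 (Filter.Eventually.of_forall fun σ hσ => ?_)
      rw [Real.norm_of_nonneg (integral_nonneg fun _ => norm_nonneg _)]
      simp only [Function.uncurry_apply_pair, F, norm_mul, Complex.norm_real, Real.norm_eq_abs,
        integral_mul_const]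
      exact mul_le_mul_of_nonneg_right (hgM σ hσ) (norm_nonneg _)
  calc _ = ∫ τ in Set.Ioo 0 t, ∫ σ in Set.Ioo 0 t, F τ σ := by
        refine setIntegral_congr_fun measurableSet_Ioo fun τ hτ => ?_
        have h1 : (fun σ => F τ σ) = (Set.Iio τ).indicator (fun σ => (volterraI (t - τ) : ℂ) *
            (((-Real.eulerMascheroniConstant - Real.log (τ - σ) : ℝ) : ℂ) * f σ)) := by
          ext σ
          simp only [F, g, Set.indicator_apply, Set.mem_Iio]
          split_ifs
          · push_cast; ring
          · simp
        simp only [h1]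
        rw [setIntegral_indicator measurableSet_Iio, integral_const_mul]
        congr 3
        ext σ
        simp only [Set.mem_inter_iff, Set.mem_Ioo, Set.mem_Iio]
        exact ⟨fun h => ⟨⟨h.1, h.2.trans hτ.2⟩, h.2⟩, fun h => ⟨h.1.1, h.2⟩⟩
    _ = ∫ σ in Set.Ioo 0 t, ∫ τ in Set.Ioo 0 t, F τ σ := integral_integral_swap hprod
    _ = _ := by
        refine setIntegral_congr_fun measurableSet_Ioo fun σ hσ => ?_
        simp only [F, integral_mul_const, integral_complex_ofReal, hg1 σ hσ]
        simp
end

section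
/- Let N ≥ 1, let y₁, …, y_N ∈ ℝ² be pairwise distinct, let α₁, …, α_N : ℝ → ℝ be continuously differentiable, let s < T, and let f : [s, T] → ℂ^N be continuous. Define the N×N matrix kernel K(t,τ) for s ≤ τ ≤ t ≤ T by K_{jj}(t,τ) := 4π I(t−τ) (α_j(τ) − (1/2π) log 2 + γ/(2π)) on the diagonal, and K_{jk}(t,τ) := −2i I(t−τ) · lim_{ε→0⁺} ∫ₛ^{τ−ε} U₀(τ−σ; |y_j − y_k|) dσ for j ≠ k. Then there exists exactly one continuous function q : [s, T] → ℂ^N satisfying the Volterra integral equation q(t) + ∫ₛᵗ K(t,τ) q(τ) dτ = f(t) for all t ∈ [s, T]. -/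
open MeasureTheory Real Filter

/-- The integral kernel of the free two-dimensional Schrödinger propagator `e^{iΔt}`
at time `t` and distance `r`: `U₀(t; r) = e^{i r²/(4t)} / (2 i t)`. -/
noncomputable def U0 (t r : ℝ) : ℂ :=
  Complex.exp (Complex.I * r ^ 2 / (4 * t)) / (2 * Complex.I * t)

/-- The improper integral `lim_{ε→0⁺} ∫ₛ^{τ-ε} U₀(τ-σ; a) dσ`. -/
noncomputable def freeImproper (s τ a : ℝ) : ℂ :=
  limUnder (nhdsWithin 0 (Set.Ioi 0)) (fun ε : ℝ => ∫ σ in s..(τ - ε), U0 (τ - σ) a)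

/-- The matrix-valued kernel of the charge equation. -/
noncomputable def chargeKernel {N : ℕ} (y : Fin N → EuclideanSpace ℝ (Fin 2))
    (α : Fin N → ℝ → ℝ) (s t τ : ℝ) : Matrix (Fin N) (Fin N) ℂ :=
  fun j k =>
    if j = k then
      ((4 * Real.pi * volterraI (t - τ) *
        (α j τ - (1 / (2 * Real.pi)) * Real.log 2 +
          Real.eulerMascheroniConstant / (2 * Real.pi)) : ℝ) : ℂ)
    else
      -2 * Complex.I * (volterraI (t - τ) : ℂ) * freeImproper s τ ‖y j - y k‖

lemma gam_aux (l σ : ℝ) (hl : 1 < l) (hσ : 0 < σ) :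
    ∫ t in Set.Ioi (0:ℝ), exp (-l * t) * (t ^ (σ - 1) / Real.Gamma σ) = exp (-(log l) * σ) := by
  have h := Real.integral_rpow_mul_exp_neg_mul_Ioi hσ (by linarith : 0 < l)
  have hG := (Real.Gamma_pos_of_pos hσ).ne'
  calc _ = ∫ t in Set.Ioi (0:ℝ), (Real.Gamma σ)⁻¹ * (t ^ (σ - 1) * exp (-(l * t))) := by
        congr 1; ext t; rw [neg_mul]; field_simp
    _ = _ := by
        rw [integral_const_mul, h, mul_comm, mul_assoc, mul_inv_cancel₀ hG, mul_one,
          one_div, Real.inv_rpow (by linarith), Real.rpow_def_of_pos (by linarith), ← Real.exp_neg]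
        ring_nf

lemma gam_aux_int (l σ : ℝ) (hl : 1 < l) (hσ : 0 < σ) :
    IntegrableOn (fun t => exp (-l * t) * (t ^ (σ - 1) / Real.Gamma σ)) (Set.Ioi (0:ℝ)) := by
  by_contra h
  have := gam_aux l σ hl hσ
  rw [integral_undef h] at this
  exact (exp_pos _).ne this

lemma volterraI_nonneg (t : ℝ) (ht : 0 < t) : 0 ≤ volterraI t := by
  unfold volterraI
  refine setIntegral_nonneg measurableSet_Ioi fun σ hσ => ?_
  have := Real.Gamma_pos_of_pos (Set.mem_Ioi.1 hσ)
  positivity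

lemma volterra_prod (l : ℝ) (hl : 1 < l) :
    Integrable (fun p : ℝ × ℝ => exp (-l * p.1) * (p.1 ^ (p.2 - 1) / Real.Gamma p.2))
      ((volume.restrict (Set.Ioi (0:ℝ))).prod (volume.restrict (Set.Ioi (0:ℝ)))) := by
  have hm : AEStronglyMeasurable
      (fun p : ℝ × ℝ => exp (-l * p.1) * (p.1 ^ (p.2 - 1) / Real.Gamma p.2))
      ((volume.restrict (Set.Ioi (0:ℝ))).prod (volume.restrict (Set.Ioi (0:ℝ)))) := by
    rw [Measure.prod_restrict]
    refine ContinuousOn.aestronglyMeasurable ?_ (measurableSet_Ioi.prod measurableSet_Ioi)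
    rintro ⟨t, σ⟩ ⟨ht, hσ⟩
    simp only [Set.mem_Ioi] at ht hσ
    apply ContinuousAt.continuousWithinAt
    have h1 : ContinuousAt (fun p : ℝ × ℝ => Real.Gamma p.2) (t, σ) := by
      have : ContinuousAt Real.Gamma σ := by
        apply DifferentiableAt.continuousAt (𝕜 := ℝ)
        apply Real.differentiableAt_Gamma
        intro m hm
        have : (0:ℝ) ≤ m := Nat.cast_nonneg m
        linarith
      exact ContinuousAt.comp (f := Prod.snd) (x := (t, σ)) this continuousAt_snd
    have h2 : ContinuousAt (fun p : ℝ × ℝ => p.1 ^ (p.2 - 1)) (t, σ) :=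
      ContinuousAt.rpow continuousAt_fst (continuousAt_snd.sub continuousAt_const) (Or.inl ht.ne')
    have h3 : ContinuousAt (fun p : ℝ × ℝ => exp (-l * p.1)) (t, σ) := by fun_prop
    exact h3.mul (h2.div h1 (Real.Gamma_pos_of_pos hσ).ne')
  rw [integrable_prod_iff' hm]
  constructor
  · filter_upwards [ae_restrict_mem measurableSet_Ioi] with σ hσ
    exact gam_aux_int l σ hl hσ
  · have h1 : IntegrableOn (fun σ => exp (-(log l) * σ)) (Set.Ioi (0:ℝ)) :=
      integrableOn_exp_mul_Ioi (by linarith [Real.log_pos hl]) 0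
    refine h1.congr ?_
    filter_upwards [ae_restrict_mem measurableSet_Ioi] with σ hσ
    rw [← gam_aux l σ hl hσ]
    refine setIntegral_congr_fun measurableSet_Ioi fun t ht => ?_
    have := Real.Gamma_pos_of_pos (Set.mem_Ioi.1 hσ)
    have ht : 0 < t := ht
    rw [Real.norm_of_nonneg (by positivity)]

lemma volterra_int (l : ℝ) (hl : 1 < l) :
    IntegrableOn (fun t => exp (-l * t) * volterraI t) (Set.Ioi (0:ℝ)) ∧
    ∫ t in Set.Ioi (0:ℝ), ‖exp (-l * t) * volterraI t‖ = 1 / log l := by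
  have h := volterra_prod l hl
  have e : ∀ t, ∫ σ in Set.Ioi (0:ℝ), exp (-l * t) * (t ^ (σ - 1) / Real.Gamma σ)
      = exp (-l * t) * volterraI t := fun t => by rw [integral_const_mul, volterraI]
  constructor
  · have := h.integral_prod_left
    simp only [e] at this
    exact this
  · calc _ = ∫ t in Set.Ioi (0:ℝ), exp (-l * t) * volterraI t := by
          refine setIntegral_congr_fun measurableSet_Ioi fun t ht => ?_
          exact Real.norm_of_nonneg (mul_nonneg (exp_pos _).le (volterraI_nonneg t ht))
      _ = ∫ t in Set.Ioi (0:ℝ), ∫ σ in Set.Ioi (0:ℝ),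
            exp (-l * t) * (t ^ (σ - 1) / Real.Gamma σ) := by simp only [e]
      _ = ∫ σ in Set.Ioi (0:ℝ), ∫ t in Set.Ioi (0:ℝ),
            exp (-l * t) * (t ^ (σ - 1) / Real.Gamma σ) := integral_integral_swap h
      _ = ∫ σ in Set.Ioi (0:ℝ), exp (-(log l) * σ) :=
          setIntegral_congr_fun measurableSet_Ioi fun σ hσ => gam_aux l σ hl hσ
      _ = _ := by
          rw [integral_exp_mul_Ioi (by linarith [Real.log_pos hl])]
          simp

/-- Convolution-type Volterra operator. -/
noncomputable def VV {E : Type*} [NormedAddCommGroup E] [NormedSpace ℝ E] (s : ℝ) (k : ℝ → ℝ)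
    (g : ℝ → E) (t : ℝ) : E :=
  ∫ u in Set.Ioi (0:ℝ), k u • (Set.Ioi s).indicator g (t - u)

section VVsec
variable {E : Type*} [NormedAddCommGroup E] [NormedSpace ℝ E] [CompleteSpace E]

lemma VV_eq (s : ℝ) (k : ℝ → ℝ) (g : ℝ → E) (t : ℝ) (ht : s ≤ t) :
    VV s k g t = ∫ τ in s..t, k (t - τ) • g τ := by
  have h := intervalIntegral.integral_comp_sub_left (fun u => k u • g (t - u)) t (a := s) (b := t)
  simp only [sub_sub_cancel, sub_self] at h
  rw [h, intervalIntegral.integral_of_le (by linarith), integral_Ioc_eq_integral_Ioo,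
    ← integral_indicator measurableSet_Ioo, VV, ← integral_indicator measurableSet_Ioi]
  congr 1
  ext u
  by_cases h0 : 0 < u <;> by_cases h1 : u < t - s
  · simp [Set.indicator, h0, h1, lt_sub_comm.1 h1]
  · simp [Set.indicator, h0, h1, lt_sub_comm (a := s)]
  · simp [Set.indicator, h0]
  · simp [Set.indicator, h0]

lemma VV_norm (s : ℝ) (k : ℝ → ℝ) (hk : IntegrableOn k (Set.Ioi 0)) (g : ℝ → E) (C : ℝ)
    (hC : ∀ x, ‖g x‖ ≤ C) (t : ℝ) :
    ‖VV s k g t‖ ≤ (∫ u in Set.Ioi (0:ℝ), ‖k u‖) * C := by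
  rw [VV, ← integral_mul_const]
  refine norm_integral_le_of_norm_le (hk.norm.mul_const C) (ae_of_all _ fun u => ?_)
  rw [norm_smul]
  gcongr
  exact (norm_indicator_le_norm_self _ _).trans (hC _)

lemma VV_meas (s : ℝ) (k : ℝ → ℝ) (hk : IntegrableOn k (Set.Ioi 0)) (g : ℝ → E)
    (hg : Continuous g) (t : ℝ) :
    AEStronglyMeasurable (fun u => k u • (Set.Ioi s).indicator g (t - u))
      (volume.restrict (Set.Ioi 0)) := by
  refine hk.aestronglyMeasurable.smul ?_
  have h : StronglyMeasurable ((Set.Ioi s).indicator g) :=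
    hg.stronglyMeasurable.indicator measurableSet_Ioi
  exact (h.comp_measurable (measurable_const.sub measurable_id)).aestronglyMeasurable

lemma VV_integrable (s : ℝ) (k : ℝ → ℝ) (hk : IntegrableOn k (Set.Ioi 0)) (g : ℝ → E)
    (hg : Continuous g) (C : ℝ) (hC : ∀ x, ‖g x‖ ≤ C) (t : ℝ) :
    IntegrableOn (fun u => k u • (Set.Ioi s).indicator g (t - u)) (Set.Ioi 0) := by
  refine Integrable.mono' (hk.norm.mul_const C) (VV_meas s k hk g hg t) (ae_of_all _ fun u => ?_)
  rw [norm_smul]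
  gcongr
  exact (norm_indicator_le_norm_self _ _).trans (hC _)

lemma VV_cont (s : ℝ) (k : ℝ → ℝ) (hk : IntegrableOn k (Set.Ioi 0)) (g : ℝ → E)
    (hg : Continuous g) (C : ℝ) (hC : ∀ x, ‖g x‖ ≤ C) : Continuous (VV s k g) := by
  rw [continuous_iff_continuousAt]
  intro t
  unfold VV
  refine continuousAt_of_dominated (bound := fun u => ‖k u‖ * C) ?_ ?_ (hk.norm.mul_const C) ?_
  · exact Eventually.of_forall fun t => VV_meas s k hk g hg t
  · refine Eventually.of_forall fun t => ae_of_all _ fun u => ?_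
    rw [norm_smul]
    gcongr
    exact (norm_indicator_le_norm_self _ _).trans (hC _)
  · have : ∀ᵐ u ∂(volume.restrict (Set.Ioi (0:ℝ))), u ≠ t - s :=
      ae_restrict_of_ae (Measure.ae_ne volume (t - s))
    filter_upwards [this] with u hu
    refine continuousAt_const.smul ?_
    have h : ContinuousAt ((Set.Ioi s).indicator g) (t - u) := by
      have hne : t - u ≠ s := fun h => hu (by linarith)
      rcases lt_or_gt_of_ne hne with h | h
      · refine (continuousAt_const (y := (0:E))).congr ?_
        filter_upwards [Iio_mem_nhds h] with x hx
        rw [Set.indicator_of_notMem]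
        simpa using le_of_lt hx
      · refine hg.continuousAt.congr ?_
        filter_upwards [Ioi_mem_nhds h] with x hx
        rw [Set.indicator_of_mem hx]
    exact ContinuousAt.comp (f := fun x => x - u) h (by fun_prop)

lemma VV_sub (s : ℝ) (k : ℝ → ℝ) (hk : IntegrableOn k (Set.Ioi 0)) (g g' : ℝ → E)
    (hg : Continuous g) (hg' : Continuous g') (C C' : ℝ) (hC : ∀ x, ‖g x‖ ≤ C)
    (hC' : ∀ x, ‖g' x‖ ≤ C') (t : ℝ) :
    VV s k g t - VV s k g' t = VV s k (fun x => g x - g' x) t := by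
  unfold VV
  rw [← integral_sub (VV_integrable s k hk g hg C hC t) (VV_integrable s k hk g' hg' C' hC' t)]
  congr 1
  ext u
  rw [← smul_sub]
  congr 1
  simp only [Set.indicator]
  split_ifs <;> simp

/-- Abstract existence and uniqueness for small kernels. -/
lemma small_kernel (s T : ℝ) (hsT : s ≤ T) (k : ℝ → ℝ) (hk : IntegrableOn k (Set.Ioi 0))
    (B : ℝ → E →ₗ[ℝ] E) (C : ℝ) (hC0 : 0 ≤ C) (hC : ∀ τ ∈ Set.Icc s T, ∀ v, ‖B τ v‖ ≤ C * ‖v‖)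
    (hB : ∀ p : ℝ → E, ContinuousOn p (Set.Icc s T) →
      ContinuousOn (fun τ => B τ (p τ)) (Set.Icc s T))
    (hsmall : (∫ u in Set.Ioi (0:ℝ), ‖k u‖) * C < 1)
    (f : ℝ → E) (hf : ContinuousOn f (Set.Icc s T)) :
    ∃ p : ℝ → E, (ContinuousOn p (Set.Icc s T) ∧
      ∀ t ∈ Set.Icc s T, p t + ∫ τ in s..t, k (t - τ) • B τ (p τ) = f t) ∧
      ∀ p' : ℝ → E, (ContinuousOn p' (Set.Icc s T) ∧
        ∀ t ∈ Set.Icc s T, p' t + ∫ τ in s..t, k (t - τ) • B τ (p' τ) = f t) →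
        Set.EqOn p p' (Set.Icc s T) := by
  have hc : ∀ p : C(Set.Icc s T, E), Continuous (fun τ : Set.Icc s T => B τ (p τ)) := by
    intro p
    have h := hB (Set.IccExtend hsT p) (p.continuous.Icc_extend').continuousOn
    rw [continuousOn_iff_continuous_domRestrict] at h
    convert h using 2 with τ
    simp
  let G : C(Set.Icc s T, E) → ℝ → E := fun p => Set.IccExtend hsT (fun τ => B τ (p τ))
  have hG : ∀ p, Continuous (G p) := fun p => (hc p).Icc_extend'
  have hGb : ∀ p x, ‖G p x‖ ≤ C * ‖p‖ := by
    intro p x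
    refine (hC _ (Set.projIcc s T hsT x).2 _).trans ?_
    gcongr
    exact p.norm_coe_le_norm _
  let Φ : C(Set.Icc s T, E) → C(Set.Icc s T, E) := fun p =>
    ⟨fun t => f t - VV s k (G p) t,
      (continuousOn_iff_continuous_domRestrict.1 hf).sub
        ((VV_cont s k hk (G p) (hG p) _ (hGb p)).comp continuous_subtype_val)⟩
  have hI0 : 0 ≤ ∫ u in Set.Ioi (0:ℝ), ‖k u‖ := integral_nonneg fun _ => norm_nonneg _
  have hΦ : ContractingWith (Real.toNNReal ((∫ u in Set.Ioi (0:ℝ), ‖k u‖) * C)) Φ := by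
    refine ⟨by rwa [Real.toNNReal_lt_one], LipschitzWith.of_dist_le_mul fun p p' => ?_⟩
    rw [Real.coe_toNNReal _ (by positivity), ContinuousMap.dist_le (by positivity)]
    intro t
    have e : Φ p t - Φ p' t = VV s k (fun x => G p' x - G p x) t := by
      rw [← VV_sub s k hk _ _ (hG p') (hG p) _ _ (hGb p') (hGb p)]
      change (f t - VV s k (G p) t) - (f t - VV s k (G p') t) = _
      abel
    rw [dist_eq_norm, e]
    refine (VV_norm s k hk _ (C * dist p p') (fun x => ?_) t).trans_eq ?_
    · change ‖B _ (p' _) - B _ (p _)‖ ≤ _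
      rw [← map_sub]
      refine (hC _ (Set.projIcc s T hsT x).2 _).trans ?_
      gcongr
      rw [← dist_eq_norm, dist_comm]
      exact ContinuousMap.dist_apply_le_dist _
    · ring
  have key : ∀ (p : C(Set.Icc s T, E)) (r : ℝ → E), (∀ x : Set.Icc s T, r x = p x) →
      ∀ t : Set.Icc s T, ∫ τ in s..t, k (t - τ) • B τ (r τ) = VV s k (G p) t := by
    intro p r hr t
    rw [VV_eq _ _ _ _ t.2.1]
    refine intervalIntegral.integral_congr fun τ hτ => ?_
    rw [Set.uIcc_of_le t.2.1] at hτ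
    have hτ' : τ ∈ Set.Icc s T := ⟨hτ.1, hτ.2.trans t.2.2⟩
    have : G p τ = B τ (p ⟨τ, hτ'⟩) := by
      simp only [G]
      rw [Set.IccExtend_of_mem hsT _ hτ']
    simp only [this]
    rw [← hr ⟨τ, hτ'⟩]
  obtain ⟨p, hp⟩ : ∃ p, Φ p = p := ⟨_, hΦ.fixedPoint_isFixedPt⟩
  refine ⟨Set.IccExtend hsT p, ⟨p.continuous.Icc_extend'.continuousOn, fun t ht => ?_⟩, ?_⟩
  · rw [key p _ (fun x => by simp) ⟨t, ht⟩, Set.IccExtend_of_mem hsT _ ht]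
    have : Φ p ⟨t, ht⟩ = p ⟨t, ht⟩ := by rw [hp]
    rw [← this]
    change (f t - VV s k (G p) t) + _ = _
    simp
  · rintro p' ⟨hp'c, hp'⟩ t ht
    let P' : C(Set.Icc s T, E) := ⟨fun t => p' t, continuousOn_iff_continuous_domRestrict.1 hp'c⟩
    have hfix : Φ P' = P' := by
      ext1 t
      change f t - VV s k (G P') t = p' t
      rw [← key P' p' (fun _ => rfl) t, ← hp' t t.2]
      simp
    have : p = P' := hΦ.fixedPoint_unique' hp hfix
    rw [Set.IccExtend_of_mem hsT _ ht, this]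
    rfl

lemma volterra_abstract (s T : ℝ) (hsT : s ≤ T)
    (B : ℝ → E →ₗ[ℝ] E) (C : ℝ) (hC0 : 0 ≤ C) (hC : ∀ τ ∈ Set.Icc s T, ∀ v, ‖B τ v‖ ≤ C * ‖v‖)
    (hB : ∀ p : ℝ → E, ContinuousOn p (Set.Icc s T) →
      ContinuousOn (fun τ => B τ (p τ)) (Set.Icc s T))
    (f : ℝ → E) (hf : ContinuousOn f (Set.Icc s T)) :
    ∃ p : ℝ → E, (ContinuousOn p (Set.Icc s T) ∧
      ∀ t ∈ Set.Icc s T, p t + ∫ τ in s..t, volterraI (t - τ) • B τ (p τ) = f t) ∧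
      ∀ p' : ℝ → E, (ContinuousOn p' (Set.Icc s T) ∧
        ∀ t ∈ Set.Icc s T, p' t + ∫ τ in s..t, volterraI (t - τ) • B τ (p' τ) = f t) →
        Set.EqOn p p' (Set.Icc s T) := by
  set l := exp (C + 1) with hl
  have hl1 : 1 < l := by rw [hl]; exact Real.one_lt_exp_iff.2 (by linarith)
  obtain ⟨h1, h2⟩ := volterra_int l hl1
  have hsm : (∫ t in Set.Ioi (0:ℝ), ‖exp (-l * t) * volterraI t‖) * C < 1 := by
    rw [h2, hl, Real.log_exp, one_div, inv_mul_lt_iff₀ (by linarith)]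
    linarith
  have hce : ∀ c : ℝ, Continuous (fun t : ℝ => exp (c * t)) := fun c => by fun_prop
  obtain ⟨p, ⟨hpc, hp⟩, hu⟩ := small_kernel s T hsT _ h1 B C hC0 hC hB hsm
    (fun t => exp (-l * t) • f t) ((hce _).continuousOn.smul hf)
  have hee : ∀ t, exp (l * t) * exp (-l * t) = 1 := fun t => by
    rw [← Real.exp_add]; simp
  refine ⟨fun t => exp (l * t) • p t, ⟨(hce _).continuousOn.smul hpc, fun t ht => ?_⟩, ?_⟩
  · have h := congrArg (fun v => exp (l * t) • v) (hp t ht)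
    simp only [smul_add, smul_smul, hee, one_smul] at h
    rw [← h, ← intervalIntegral.integral_smul]
    congr 2
    ext τ
    rw [map_smul, smul_smul, smul_smul, ← mul_assoc, ← Real.exp_add]
    congr 1
    rw [mul_comm]
    congr 2
    ring
  · rintro q ⟨hqc, hq⟩ t ht
    have h := hu (fun t => exp (-l * t) • q t) ⟨(hce _).continuousOn.smul hqc, fun t ht => ?_⟩ ht
    · simp only [h, smul_smul, hee, one_smul]
    · rw [← hq t ht, smul_add, ← intervalIntegral.integral_smul]
      congr 2
      ext τ
      rw [map_smul, smul_smul, smul_smul, mul_right_comm, ← Real.exp_add]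
      congr 3
      ring

end VVsec

/-- Bounded oscillating phase. -/
noncomputable def ph (b u : ℝ) : ℂ := Complex.exp (Complex.I * b / u)

lemma ph_norm (b u : ℝ) : ‖ph b u‖ = 1 := by
  have : Complex.I * b / u = ((b / u : ℝ) : ℂ) * Complex.I := by push_cast; ring
  rw [ph, this, Complex.norm_exp_ofReal_mul_I]

lemma ph_meas (b : ℝ) : Measurable (ph b) := by
  unfold ph; fun_prop

lemma ph_int (b x y : ℝ) : IntervalIntegrable (ph b) volume x y := by
  refine (intervalIntegrable_const (c := (1:ℝ))).mono_fun (ph_meas b).aestronglyMeasurable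
    (ae_of_all _ fun u => ?_)
  simp [ph_norm]

lemma ph_deriv (b u : ℝ) (hu : u ≠ 0) :
    HasDerivAt (fun u : ℝ => (u : ℂ) * ph b u) (ph b u - Complex.I * b * (ph b u / u)) u := by
  have hu' : (u : ℂ) ≠ 0 := by exact_mod_cast hu
  have h1 : HasDerivAt (fun u : ℝ => (u : ℂ)) 1 u := Complex.ofRealCLM.hasDerivAt
  have h2 : HasDerivAt (ph b) (ph b u * ((0 * u - Complex.I * b * 1) / (u : ℂ) ^ 2)) u :=
    (((hasDerivAt_const u (Complex.I * (b:ℂ))).div h1 hu').cexp)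
  have e : ph b u - Complex.I * b * (ph b u / u) =
      1 * ph b u + u * (ph b u * ((0 * u - Complex.I * b * 1) / (u : ℂ) ^ 2)) := by
    field_simp
    ring
  rw [e]
  exact h1.mul h2

lemma ph_cont (b : ℝ) : Continuous (fun u : ℝ => (u : ℂ) * ph b u) := by
  rw [continuous_iff_continuousAt]
  intro u
  by_cases hu : u = 0
  · subst hu
    rw [ContinuousAt]
    simp only [Complex.ofReal_zero, zero_mul]
    rw [tendsto_zero_iff_norm_tendsto_zero]
    simp only [norm_mul, ph_norm, mul_one, Complex.norm_real]
    exact tendsto_norm_zero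
  · exact (ph_deriv b u hu).continuousAt

/-- The value of the improper integral. -/
noncomputable def GG (b L : ℝ) : ℂ :=
  -(1 / (2 * b)) * ((∫ u in (0:ℝ)..L, ph b u) - L * ph b L)

lemma GG_cont (b : ℝ) : Continuous (GG b) := by
  unfold GG
  exact continuous_const.mul
    ((intervalIntegral.continuous_primitive (ph_int b) 0).sub (ph_cont b))

lemma GG_eq (b e L : ℝ) (hb : b ≠ 0) (he : 0 < e) (hL : 0 < L) :
    ∫ u in e..L, ph b u / (2 * Complex.I * u) = GG b L - GG b e := by
  have hne : ∀ u ∈ Set.uIcc e L, u ≠ 0 := fun u hu =>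
    (lt_of_lt_of_le (lt_min he hL) hu.1).ne'
  have hb' : (b : ℂ) ≠ 0 := by exact_mod_cast hb
  have hcp : ContinuousOn (ph b) (Set.uIcc e L) := by
    unfold ph
    refine Complex.continuous_exp.comp_continuousOn
      (continuousOn_const.div Complex.continuous_ofReal.continuousOn fun u hu => ?_)
    exact_mod_cast hne u hu
  have hcd : ContinuousOn (fun u : ℝ => ph b u / u) (Set.uIcc e L) :=
    hcp.div Complex.continuous_ofReal.continuousOn fun u hu => by exact_mod_cast hne u hu
  have hi : IntervalIntegrable (fun u : ℝ => Complex.I * b * (ph b u / u)) volume e L :=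
    (continuousOn_const.mul hcd).intervalIntegrable
  have h := intervalIntegral.integral_eq_sub_of_hasDerivAt
    (fun u hu => ph_deriv b u (hne u hu)) ((ph_int b e L).sub hi)
  rw [intervalIntegral.integral_sub (ph_int b e L) hi, intervalIntegral.integral_const_mul] at h
  have h3 : ∫ u in e..L, ph b u / (2 * Complex.I * u)
      = (1 / (2 * Complex.I)) * ∫ u in e..L, ph b u / u := by
    rw [← intervalIntegral.integral_const_mul]
    congr 1; ext u
    rw [div_mul_div_comm, one_mul]
  have h4 := intervalIntegral.integral_interval_sub_left (ph_int b 0 L) (ph_int b 0 e)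
  rw [h3, GG, GG]
  rw [← h4] at h
  set J := ∫ u in e..L, ph b u / u
  have hJ : J = (((∫ u in (0:ℝ)..L, ph b u) - ∫ u in (0:ℝ)..e, ph b u)
      - (L * ph b L - e * ph b e)) / (Complex.I * b) := by
    rw [← h]; field_simp; ring
  rw [hJ]
  field_simp
  rw [Complex.I_sq]
  ring

lemma freeImproper_eq (s τ a : ℝ) (ha : a ≠ 0) (hτ : s < τ) :
    freeImproper s τ a = GG (a ^ 2 / 4) (τ - s) := by
  unfold freeImproper
  apply Tendsto.limUnder_eq
  have hb : a ^ 2 / 4 ≠ 0 := by positivity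
  have h0 : GG (a ^ 2 / 4) 0 = 0 := by simp [GG]
  have ht : Tendsto (fun e => GG (a ^ 2 / 4) (τ - s) - GG (a ^ 2 / 4) e)
      (nhdsWithin 0 (Set.Ioi 0)) (nhds (GG (a ^ 2 / 4) (τ - s))) := by
    have : Tendsto (fun e => GG (a ^ 2 / 4) (τ - s) - GG (a ^ 2 / 4) e) (nhds 0)
      (nhds (GG (a ^ 2 / 4) (τ - s) - GG (a ^ 2 / 4) 0)) :=
      (continuous_const.sub (GG_cont _)).tendsto 0
    rw [h0, sub_zero] at this
    exact this.mono_left nhdsWithin_le_nhds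
  refine ht.congr' ?_
  filter_upwards [self_mem_nhdsWithin] with e he
  rw [← GG_eq _ e (τ - s) hb he (by linarith),
    intervalIntegral.integral_comp_sub_left (fun u => U0 u a) τ, sub_sub_cancel]
  congr 1
  ext u
  simp only [U0, ph]
  congr 2
  push_cast
  rw [mul_div_assoc', div_div]

/-- The continuous matrix factor of the kernel. -/
noncomputable def MM {N : ℕ} (y : Fin N → EuclideanSpace ℝ (Fin 2))
    (α : Fin N → ℝ → ℝ) (s τ : ℝ) : Matrix (Fin N) (Fin N) ℂ :=
  fun j k =>
    if j = k then
      ((4 * Real.pi *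
        (α j τ - (1 / (2 * Real.pi)) * Real.log 2 +
          Real.eulerMascheroniConstant / (2 * Real.pi)) : ℝ) : ℂ)
    else
      -2 * Complex.I * GG (‖y j - y k‖ ^ 2 / 4) (τ - s)

lemma MM_cont {N : ℕ} (y : Fin N → EuclideanSpace ℝ (Fin 2))
    (α : Fin N → ℝ → ℝ) (hα : ∀ j, Continuous (α j)) (s : ℝ) (j k : Fin N) :
    Continuous (fun τ => MM y α s τ j k) := by
  unfold MM
  split_ifs
  · have := hα j
    exact Complex.continuous_ofReal.comp (by fun_prop)
  · exact continuous_const.mul ((GG_cont _).comp (by fun_prop))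

lemma kernel_eq {N : ℕ} (y : Fin N → EuclideanSpace ℝ (Fin 2))
    (hy : Function.Injective y) (α : Fin N → ℝ → ℝ) (s t τ : ℝ) (h : s < τ) :
    chargeKernel y α s t τ = volterraI (t - τ) • MM y α s τ := by
  ext j k
  simp only [chargeKernel, MM, Matrix.smul_apply]
  split_ifs with hjk
  · rw [Complex.real_smul, ← Complex.ofReal_mul]
    congr 1
    ring
  · rw [freeImproper_eq _ _ _ (norm_ne_zero_iff.2 (sub_ne_zero.2 (hy.ne hjk))) h,
      Complex.real_smul]
    ring

/-- Existence and uniqueness of a continuous solution on `[s,T]` of the Volterra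
integral equation `q(t) + ∫ₛᵗ K(t,τ) q(τ) dτ = f(t)` (the charge equation). -/
theorem charge_equation_exists_unique
    {N : ℕ} (hN : 1 ≤ N) (y : Fin N → EuclideanSpace ℝ (Fin 2))
    (hy : Function.Injective y) (α : Fin N → ℝ → ℝ)
    (hα : ∀ j, ContDiff ℝ 1 (α j)) (s T : ℝ) (hsT : s < T)
    (f : ℝ → Fin N → ℂ) (hf : ContinuousOn f (Set.Icc s T)) :
    ∃ q : ℝ → Fin N → ℂ,
      (ContinuousOn q (Set.Icc s T) ∧
        ∀ t ∈ Set.Icc s T,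
          q t + ∫ τ in s..t, (chargeKernel y α s t τ).mulVec (q τ) = f t) ∧
      ∀ q' : ℝ → Fin N → ℂ,
        (ContinuousOn q' (Set.Icc s T) ∧
          ∀ t ∈ Set.Icc s T,
            q' t + ∫ τ in s..t, (chargeKernel y α s t τ).mulVec (q' τ) = f t) →
        Set.EqOn q q' (Set.Icc s T) := by
  have hM := MM_cont y α (fun j => (hα j).continuous) s
  have hbd : ∀ j k, ∃ C : ℝ, ∀ τ ∈ Set.Icc s T, ‖MM y α s τ j k‖ ≤ C := fun j k =>
    isCompact_Icc.exists_bound_of_continuousOn (hM j k).continuousOn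
  choose c hc using hbd
  have hc0 : ∀ j k, 0 ≤ c j k := fun j k =>
    (norm_nonneg _).trans (hc j k s (Set.left_mem_Icc.2 hsT.le))
  have hint : ∀ (q : ℝ → Fin N → ℂ), ∀ t ∈ Set.Icc s T,
      ∫ τ in s..t, (chargeKernel y α s t τ).mulVec (q τ)
        = ∫ τ in s..t, volterraI (t - τ) •
          (((MM y α s τ).mulVecLin).restrictScalars ℝ) (q τ) := by
    intro q t ht
    rw [intervalIntegral.integral_of_le ht.1, intervalIntegral.integral_of_le ht.1]
    refine setIntegral_congr_fun measurableSet_Ioc fun τ hτ => ?_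
    simp only [kernel_eq y hy α s t τ hτ.1, LinearMap.coe_restrictScalars,
      Matrix.mulVecLin_apply, Matrix.smul_mulVec]
  have main := volterra_abstract s T hsT.le
    (fun τ => ((MM y α s τ).mulVecLin).restrictScalars ℝ) (∑ j, ∑ k, c j k)
    (Finset.sum_nonneg fun j _ => Finset.sum_nonneg fun k _ => hc0 j k) ?_ ?_ f hf
  · obtain ⟨q, ⟨h1, h2⟩, h3⟩ := main
    refine ⟨q, ⟨h1, fun t ht => ?_⟩, fun q' hq' => h3 q' ⟨hq'.1, fun t ht => ?_⟩⟩
    · rw [hint q t ht]; exact h2 t ht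
    · rw [← hint q' t ht]; exact hq'.2 t ht
  · intro τ hτ v
    simp only [LinearMap.coe_restrictScalars, Matrix.mulVecLin_apply]
    have hS : 0 ≤ ∑ j, ∑ k, c j k :=
      Finset.sum_nonneg fun j _ => Finset.sum_nonneg fun k _ => hc0 j k
    rw [pi_norm_le_iff_of_nonneg (by positivity)]
    intro j
    calc ‖(MM y α s τ).mulVec v j‖ ≤ ∑ k, ‖MM y α s τ j k * v k‖ := by
          simp only [Matrix.mulVec, dotProduct]
          exact norm_sum_le _ _
      _ ≤ ∑ k, c j k * ‖v‖ := by
          refine Finset.sum_le_sum fun k _ => ?_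
          rw [norm_mul]
          exact mul_le_mul (hc j k τ hτ) (norm_le_pi_norm v k) (norm_nonneg _) (hc0 j k)
      _ = (∑ k, c j k) * ‖v‖ := by rw [Finset.sum_mul]
      _ ≤ _ := by
          refine mul_le_mul_of_nonneg_right ?_ (norm_nonneg _)
          exact Finset.single_le_sum (f := fun j => ∑ k, c j k)
            (fun j _ => Finset.sum_nonneg fun k _ => hc0 j k) (Finset.mem_univ j)
  · intro p hp
    rw [continuousOn_pi] at hp ⊢
    intro j
    simp only [LinearMap.coe_restrictScalars, Matrix.mulVecLin_apply, Matrix.mulVec, dotProduct]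
    exact continuousOn_finsetSum _ fun k _ => (hM j k).continuousOn.mul (hp k)
end

section
/- Let λ > 0. For every s > 0 the improper integral G(s) := lim_{R→∞} ∫₀^R e^{−i ϱ s} / (ϱ + λ) dϱ exists in ℂ, and moreover lim_{s→0⁺} ( G(s) + γ + log λ + log s ) = −iπ/2, where γ is the Euler–Mascheroni constant. -/
open MeasureTheory Real Filter

lemma aux_integral_log : ∫ t : ℝ in Set.Ioi 0, Real.log t * Real.exp (-t) =
    -Real.eulerMascheroniConstant := by
  have h1 := Complex.hasDerivAt_GammaIntegral (s := 1) (by simp)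
  have h2 : HasDerivAt Complex.GammaIntegral (-(Real.eulerMascheroniConstant : ℂ)) 1 := by
    refine Complex.hasDerivAt_Gamma_one.congr_of_eventuallyEq ?_
    have : {z : ℂ | 0 < z.re} ∈ nhds (1 : ℂ) :=
      (isOpen_lt continuous_const Complex.continuous_re).mem_nhds (by simp)
    filter_upwards [this] with z hz
    exact (Complex.Gamma_eq_integral hz).symm
  have h3 := h1.unique h2
  simp only [sub_self, Complex.cpow_zero, one_mul] at h3
  have h4 : (∫ t : ℝ in Set.Ioi 0, ((Real.log t : ℂ) * (Real.exp (-t) : ℂ))) =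
      ((∫ t : ℝ in Set.Ioi 0, Real.log t * Real.exp (-t) : ℝ) : ℂ) := by
    rw [← integral_complex_ofReal]
    simp
  rw [h4] at h3
  exact_mod_cast h3

lemma aux_integrable_log : IntegrableOn (fun t : ℝ => Real.log t * Real.exp (-t)) (Set.Ioi 0) := by
  apply Integrable.of_integral_ne_zero
  rw [aux_integral_log]
  have := Real.one_half_lt_eulerMascheroniConstant
  linarith

lemma aux_integrable_log_mul (lam : ℝ) (hlam : 0 < lam) :
    IntegrableOn (fun t : ℝ => Real.log t * Real.exp (-lam * t)) (Set.Ioi 0) := by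
  have h := (integrableOn_Ioi_comp_mul_left_iff (fun t : ℝ => Real.log t * Real.exp (-t)) 0
    hlam).2 (by simpa using aux_integrable_log)
  have h2 := (integrableOn_exp_mul_Ioi (a := -lam) (by linarith) 0).const_mul (Real.log lam)
  refine (h.sub h2).congr_fun ?_ measurableSet_Ioi
  intro t ht
  have ht' : (0:ℝ) < t := ht
  simp only [Pi.sub_apply]
  rw [Real.log_mul hlam.ne' ht'.ne', neg_mul]
  ring

lemma aux_integral_log_mul (lam : ℝ) (hlam : 0 < lam) :
    ∫ t : ℝ in Set.Ioi 0, lam * (Real.log t * Real.exp (-lam * t)) =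
      -Real.eulerMascheroniConstant - Real.log lam := by
  have h := integral_comp_mul_left_Ioi (fun t : ℝ => Real.log t * Real.exp (-t)) 0 hlam
  rw [mul_zero, aux_integral_log] at h
  have h2 := integral_exp_mul_Ioi (a := -lam) (by linarith) 0
  have hi := (integrableOn_exp_mul_Ioi (a := -lam) (by linarith) 0)
  have h3 : ∫ t : ℝ in Set.Ioi 0, Real.log (lam * t) * Real.exp (-(lam * t)) =
      ∫ t : ℝ in Set.Ioi 0, (Real.log t * Real.exp (-lam * t)
        + Real.log lam * Real.exp (-lam * t)) := by
    refine setIntegral_congr_fun measurableSet_Ioi ?_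
    intro t ht
    have ht' : (0:ℝ) < t := ht
    simp only
    rw [Real.log_mul hlam.ne' ht'.ne', neg_mul]
    ring
  rw [h3, integral_add (aux_integrable_log_mul lam hlam) (hi.const_mul _), integral_const_mul,
    h2] at h
  rw [integral_const_mul]
  simp only [smul_eq_mul, mul_zero, Real.exp_zero] at h
  field_simp at h
  simp only [neg_mul]
  linarith

/-- bounding function -/
lemma aux_bound_integrable (lam : ℝ) (hlam : 0 < lam) (c : ℝ) :
    IntegrableOn (fun t : ℝ => Real.exp (-lam * t) * (|Real.log t| + t + c)) (Set.Ioi 0) := by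
  have h1 := (aux_integrable_log_mul lam hlam).norm
  have h2 := integrableOn_rpow_mul_exp_neg_mul_rpow (p := 1) (s := 1) (b := lam)
    (by norm_num) (by norm_num) hlam
  have h3 := (integrableOn_exp_mul_Ioi (a := -lam) (by linarith) 0).const_mul c
  refine IntegrableOn.congr_fun (f := _) ((h1.add h2).add h3) ?_ measurableSet_Ioi
  intro t ht
  simp only [Pi.add_apply, norm_mul, Real.norm_eq_abs, Real.abs_exp, Real.rpow_one]
  ring

lemma aux_mem_slit (s : ℝ) (hs : 0 < s) (t : ℝ) : (t : ℂ) + s * Complex.I ∈ Complex.slitPlane := by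
  right
  simp [hs.ne']

lemma aux_norm_log (s t : ℝ) (hs : 0 < s) (ht : 0 < t) :
    ‖Complex.log ((t : ℂ) + s * Complex.I)‖ ≤ |Real.log t| + t + (s + Real.pi) := by
  set z : ℂ := (t : ℂ) + s * Complex.I with hz
  have h1 : ‖Complex.log z‖ ≤ |Real.log ‖z‖| + |Complex.arg z| := by
    have := Complex.norm_le_abs_re_add_abs_im (Complex.log z)
    simpa [Complex.log_re, Complex.log_im] using this
  have h2 := Complex.abs_arg_le_pi z
  have h3 : t ≤ ‖z‖ := by
    have := (le_abs_self _).trans (Complex.abs_re_le_norm z)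
    simpa [hz] using this
  have h4 : ‖z‖ ≤ t + s := by
    refine (norm_add_le _ _).trans ?_
    simp [abs_of_pos hs, abs_of_pos ht]
  have h5 : Real.log t ≤ Real.log ‖z‖ := Real.log_le_log ht h3
  have h6 : Real.log ‖z‖ ≤ ‖z‖ - 1 := Real.log_le_sub_one_of_pos (ht.trans_le h3)
  have h7 : |Real.log ‖z‖| ≤ |Real.log t| + t + s := by
    rw [abs_le]
    have := neg_abs_le (Real.log t)
    have := abs_nonneg (Real.log t)
    constructor <;> linarith
  linarith

lemma aux_cont_log (s : ℝ) (hs : 0 < s) :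
    Continuous (fun t : ℝ => Complex.log ((t : ℂ) + s * Complex.I)) :=
  Continuous.clog (by fun_prop) (aux_mem_slit s hs)

lemma aux_log_integrable (lam : ℝ) (hlam : 0 < lam) (s : ℝ) (hs : 0 < s) :
    IntegrableOn (fun t : ℝ => (Real.exp (-lam * t) : ℂ) *
      Complex.log ((t : ℂ) + s * Complex.I)) (Set.Ioi 0) := by
  have := aux_cont_log s hs
  refine (aux_bound_integrable lam hlam (s + Real.pi)).mono' ?_ ?_
  · exact Continuous.aestronglyMeasurable (by fun_prop)
  · filter_upwards [ae_restrict_mem measurableSet_Ioi] with t ht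
    rw [norm_mul, Complex.norm_real, Real.norm_eq_abs, Real.abs_exp]
    gcongr
    exact aux_norm_log s t hs ht

lemma aux_norm_ge (s : ℝ) (hs : 0 < s) (t : ℝ) : s ≤ ‖(t : ℂ) + s * Complex.I‖ := by
  have := (le_abs_self _).trans (Complex.abs_im_le_norm ((t : ℂ) + s * Complex.I))
  simpa using this

lemma aux_inv_integrable (lam : ℝ) (hlam : 0 < lam) (s : ℝ) (hs : 0 < s) :
    IntegrableOn (fun t : ℝ => (Real.exp (-lam * t) : ℂ) /
      ((t : ℂ) + s * Complex.I)) (Set.Ioi 0) := by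
  refine ((integrableOn_exp_mul_Ioi (a := -lam) (by linarith) 0).mul_const s⁻¹).mono' ?_ ?_
  · refine Continuous.aestronglyMeasurable (Continuous.div (by fun_prop) (by fun_prop) ?_)
    exact fun t => Complex.slitPlane_ne_zero (aux_mem_slit s hs t)
  · filter_upwards with t
    rw [norm_div, Complex.norm_real, Real.norm_eq_abs, Real.abs_exp, div_eq_mul_inv]
    gcongr
    exact aux_norm_ge s hs t

lemma aux_parts (lam : ℝ) (hlam : 0 < lam) (s : ℝ) (hs : 0 < s) :
    ∫ t : ℝ in Set.Ioi 0, (Real.exp (-lam * t) : ℂ) / ((t : ℂ) + s * Complex.I) =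
    -Complex.log (s * Complex.I) + ∫ t : ℝ in Set.Ioi 0, (lam : ℂ) * ((Real.exp (-lam * t) : ℂ) *
      Complex.log ((t : ℂ) + s * Complex.I)) := by
  have hd : ∀ t : ℝ, HasDerivAt (fun t : ℝ => (Real.exp (-lam * t) : ℂ) *
      Complex.log ((t : ℂ) + s * Complex.I))
      ((Real.exp (-lam * t) : ℂ) / ((t : ℂ) + s * Complex.I) - (lam : ℂ) *
      ((Real.exp (-lam * t) : ℂ) * Complex.log ((t : ℂ) + s * Complex.I))) t := by
    intro t
    have h1 : HasDerivAt (fun t : ℝ => Real.exp (-lam * t)) (Real.exp (-lam * t) * (-lam)) t := by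
      simpa using ((hasDerivAt_id t).const_mul (-lam)).exp
    have h2 : HasDerivAt (fun t : ℝ => (t : ℂ) + s * Complex.I) 1 t :=
      Complex.ofRealCLM.hasDerivAt.add_const _
    have h3 := h1.ofReal_comp.mul (h2.clog_real (aux_mem_slit s hs t))
    convert! h3 using 1
    push_cast
    ring
  have hi1 := aux_inv_integrable lam hlam s hs
  have hi2 := (aux_log_integrable lam hlam s hs)
  have hi3 := hi1.sub (hi2.const_mul (lam : ℂ))
  have hlim := tendsto_zero_of_hasDerivAt_of_integrableOn_Ioi (fun t _ => hd t) hi3 hi2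
  have := integral_Ioi_of_hasDerivAt_of_tendsto' (fun t _ => hd t) hi3 hlim
  rw [integral_sub hi1 (hi2.const_mul (lam : ℂ))] at this
  simp only [mul_zero, Real.exp_zero, Complex.ofReal_one, Complex.ofReal_zero, zero_add,
    one_mul, zero_sub] at this
  linear_combination this

lemma aux_exists (lam : ℝ) (hlam : 0 < lam) (s : ℝ) (hs : 0 < s) (R : ℝ) (hR : 0 < R) :
    ∫ ϱ in (0:ℝ)..R, Complex.exp (-Complex.I * ϱ * s) / ((ϱ + lam : ℝ) : ℂ) =
    (∫ t : ℝ in Set.Ioi 0, (Real.exp (-lam * t) : ℂ) / ((t : ℂ) + s * Complex.I)) -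
    ∫ t : ℝ in Set.Ioi 0, (Real.exp (-lam * t) : ℂ) / ((t : ℂ) + s * Complex.I) *
      Complex.exp (-((t : ℂ) + s * Complex.I) * R) := by
  have hi1 := aux_inv_integrable lam hlam s hs
  have hi2 : IntegrableOn (fun t : ℝ => (Real.exp (-lam * t) : ℂ) / ((t : ℂ) + s * Complex.I) *
      Complex.exp (-((t : ℂ) + s * Complex.I) * R)) (Set.Ioi 0) := by
    refine hi1.mul_bdd (c := 1) (Continuous.aestronglyMeasurable (by fun_prop)) ?_
    filter_upwards [ae_restrict_mem measurableSet_Ioi] with t ht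
    have ht' : (0:ℝ) < t := ht
    rw [Complex.norm_exp]
    simp
    positivity
  rw [← integral_sub hi1 hi2]
  have e1 : ∫ ϱ in (0:ℝ)..R, Complex.exp (-Complex.I * ϱ * s) / ((ϱ + lam : ℝ) : ℂ) =
      ∫ ϱ in (0:ℝ)..R, ∫ t : ℝ in Set.Ioi 0,
        (Real.exp (-lam * t) : ℂ) * Complex.exp (-((t : ℂ) + s * Complex.I) * ϱ) := by
    refine intervalIntegral.integral_congr ?_
    intro r hr
    rw [Set.uIcc_of_le hR.le] at hr
    have hr0 : 0 < r + lam := by linarith [hr.1]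
    have hr1 : ((r + lam : ℝ) : ℂ) ≠ 0 := by exact_mod_cast hr0.ne'
    have h := integral_exp_mul_complex_Ioi (a := ((-(r + lam) : ℝ) : ℂ))
      (by rw [Complex.ofReal_re]; linarith) 0
    have : ∀ t : ℝ, (Real.exp (-lam * t) : ℂ) * Complex.exp (-((t : ℂ) + s * Complex.I) * r) =
        Complex.exp (-Complex.I * r * s) * Complex.exp (((-(r + lam) : ℝ) : ℂ) * t) := by
      intro t
      push_cast
      rw [← Complex.exp_add, ← Complex.exp_add]
      congr 1
      ring
    simp only [this]
    rw [integral_const_mul, h]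
    push_cast at hr1 ⊢
    have hr2 : -(lam : ℂ) - r ≠ 0 := by
      intro h0
      apply hr1
      linear_combination -h0
    simp only [mul_zero, Complex.exp_zero, neg_div_neg_eq]
    ring
  rw [e1, intervalIntegral_integral_swap]
  · refine setIntegral_congr_fun measurableSet_Ioi ?_
    intro t ht
    have hz := Complex.slitPlane_ne_zero (aux_mem_slit s hs t)
    simp only
    rw [intervalIntegral.integral_const_mul, integral_exp_mul_complex (neg_ne_zero.2 hz)]
    simp only [Complex.ofReal_zero, mul_zero, Complex.exp_zero]
    field_simp
    ring
  · haveI : IsFiniteMeasure (volume.restrict (Set.uIoc 0 R)) := by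
      rw [Set.uIoc_of_le hR.le]
      infer_instance
    refine ((integrableOn_exp_mul_Ioi (a := -lam) (by linarith) 0).comp_snd
      (volume.restrict (Set.uIoc 0 R))).mono' ?_ ?_
    · refine Continuous.aestronglyMeasurable ?_
      simp only [Function.uncurry_def]
      fun_prop
    · rw [Measure.prod_restrict]
      filter_upwards [ae_restrict_mem (measurableSet_uIoc.prod measurableSet_Ioi)] with p hp
      obtain ⟨h1, h2⟩ := hp
      rw [Set.uIoc_of_le hR.le] at h1
      have h1' : 0 < p.1 := h1.1
      have h2' : 0 < p.2 := h2
      simp only [Function.uncurry_def]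
      rw [norm_mul, Complex.norm_real, Real.norm_eq_abs, Real.abs_exp, Complex.norm_exp]
      refine mul_le_of_le_one_right (Real.exp_pos _).le ?_
      simp
      positivity

lemma aux_tendsto_zero (lam : ℝ) (hlam : 0 < lam) (s : ℝ) (hs : 0 < s) :
    Tendsto (fun R : ℝ => ∫ t : ℝ in Set.Ioi 0,
      (Real.exp (-lam * t) : ℂ) / ((t : ℂ) + s * Complex.I) *
      Complex.exp (-((t : ℂ) + s * Complex.I) * R)) atTop (nhds 0) := by
  have hi1 := aux_inv_integrable lam hlam s hs
  have key := tendsto_integral_filter_of_dominated_convergence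
    (μ := volume.restrict (Set.Ioi (0:ℝ))) (l := (atTop : Filter ℝ))
    (F := fun R t => (Real.exp (-lam * t) : ℂ) / ((t : ℂ) + s * Complex.I) *
      Complex.exp (-((t : ℂ) + s * Complex.I) * R)) (f := fun _ => 0)
    (fun t => ‖(Real.exp (-lam * t) : ℂ) / ((t : ℂ) + s * Complex.I)‖) ?_ ?_ hi1.norm ?_
  · simpa using key
  · filter_upwards with R
    exact hi1.aestronglyMeasurable.mul (Continuous.aestronglyMeasurable (by fun_prop))
  · filter_upwards [eventually_gt_atTop 0] with R hR
    filter_upwards [ae_restrict_mem measurableSet_Ioi] with t ht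
    have ht' : (0:ℝ) < t := ht
    rw [norm_mul, Complex.norm_exp]
    refine mul_le_of_le_one_right (norm_nonneg _) ?_
    simp
    positivity
  · filter_upwards [ae_restrict_mem measurableSet_Ioi] with t ht
    have ht' : (0:ℝ) < t := ht
    rw [← mul_zero ((Real.exp (-lam * t) : ℂ) / ((t : ℂ) + s * Complex.I))]
    refine Tendsto.const_mul _ ?_
    rw [Complex.tendsto_exp_nhds_zero_iff]
    simpa using tendsto_id.const_mul_atTop ht'

lemma aux_tendsto_log (lam : ℝ) (hlam : 0 < lam) :
    Tendsto (fun s : ℝ => ∫ t : ℝ in Set.Ioi 0, (lam : ℂ) * ((Real.exp (-lam * t) : ℂ) *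
      Complex.log ((t : ℂ) + s * Complex.I))) (nhdsWithin 0 (Set.Ioi 0))
      (nhds (-Real.eulerMascheroniConstant - Real.log lam)) := by
  have e : ((-Real.eulerMascheroniConstant - Real.log lam : ℂ)) =
      ∫ t : ℝ in Set.Ioi 0, (lam : ℂ) * ((Real.exp (-lam * t) : ℂ) * Complex.log (t : ℂ)) := by
    have h := congrArg (fun x : ℝ => (x : ℂ)) (aux_integral_log_mul lam hlam)
    beta_reduce at h
    rw [← integral_complex_ofReal] at h
    push_cast at h
    rw [← h]
    refine setIntegral_congr_fun measurableSet_Ioi ?_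
    intro t ht
    have ht' : (0:ℝ) < t := ht
    simp only
    rw [← Complex.ofReal_log ht'.le]
    push_cast
    ring
  rw [e]
  refine tendsto_integral_filter_of_dominated_convergence
    (fun t => lam * (Real.exp (-lam * t) * (|Real.log t| + t + (1 + Real.pi)))) ?_ ?_
    ((aux_bound_integrable lam hlam (1 + Real.pi)).const_mul lam) ?_
  · filter_upwards [self_mem_nhdsWithin] with s hs
    exact ((aux_log_integrable lam hlam s hs).const_mul (lam : ℂ)).aestronglyMeasurable
  · filter_upwards [self_mem_nhdsWithin, nhdsWithin_le_nhds (Iio_mem_nhds one_pos)] with s hs hs1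
    filter_upwards [ae_restrict_mem measurableSet_Ioi] with t ht
    have hs1' : s < 1 := hs1
    rw [norm_mul, norm_mul, Complex.norm_real, Complex.norm_real, Real.norm_eq_abs,
      Real.norm_eq_abs, Real.abs_exp, abs_of_pos hlam]
    have := aux_norm_log s t hs ht
    gcongr
    linarith
  · filter_upwards [ae_restrict_mem measurableSet_Ioi] with t ht
    have ht' : (0:ℝ) < t := ht
    refine Tendsto.const_mul _ (Tendsto.const_mul _ ?_)
    have hc : ContinuousAt (fun s : ℝ => Complex.log ((t : ℂ) + s * Complex.I)) 0 := by
      refine ContinuousAt.clog (by fun_prop) ?_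
      left
      simpa using ht'
    have := hc.tendsto.mono_left (nhdsWithin_le_nhds (s := Set.Ioi 0))
    simpa using this

/-- For `λ > 0`: for every `s > 0` the improper integral
`G(s) = lim_{R→∞} ∫₀^R e^{-iϱs}/(ϱ+λ) dϱ` exists, and
`G(s) + γ + log λ + log s → -iπ/2` as `s → 0⁺`. -/
theorem improper_exponential_integral_asymptotics (lam : ℝ) (hlam : 0 < lam) :
    ∃ G : ℝ → ℂ,
      (∀ s : ℝ, 0 < s →
        Tendsto (fun R : ℝ => ∫ ϱ in (0:ℝ)..R,
            Complex.exp (-Complex.I * ϱ * s) / ((ϱ + lam : ℝ) : ℂ))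
          atTop (nhds (G s))) ∧
      Tendsto
        (fun s : ℝ => G s + Real.eulerMascheroniConstant + Real.log lam + Real.log s)
        (nhdsWithin 0 (Set.Ioi 0))
        (nhds (-Complex.I * Real.pi / 2)) := by
  refine ⟨fun s => ∫ t : ℝ in Set.Ioi 0,
    (Real.exp (-lam * t) : ℂ) / ((t : ℂ) + s * Complex.I), ?_, ?_⟩
  · intro s hs
    have h := (tendsto_const_nhds (x := ∫ t : ℝ in Set.Ioi 0,
      (Real.exp (-lam * t) : ℂ) / ((t : ℂ) + s * Complex.I))).sub (aux_tendsto_zero lam hlam s hs)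
    rw [sub_zero] at h
    refine h.congr' ?_
    filter_upwards [eventually_gt_atTop 0] with R hR
    exact (aux_exists lam hlam s hs R hR).symm
  · have h := (aux_tendsto_log lam hlam).add_const
      ((Real.eulerMascheroniConstant : ℂ) + Real.log lam - Real.pi / 2 * Complex.I)
    have e : (-Real.eulerMascheroniConstant - Real.log lam : ℂ) +
        ((Real.eulerMascheroniConstant : ℂ) + Real.log lam - Real.pi / 2 * Complex.I) =
        -Complex.I * Real.pi / 2 := by ring
    rw [e] at h
    refine h.congr' ?_
    filter_upwards [self_mem_nhdsWithin] with s hs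
    rw [aux_parts lam hlam s hs, Complex.log_ofReal_mul hs Complex.I_ne_zero, Complex.log_I]
    ring
end
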